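/- arXiv:2308.11230 — 11 statements merged into one kernel-verified Lean document; each statement's English description precedes it below -/
import Mathlib

section
/- Let n ≥ 1 and let each agent have a valuation with marginal bound 1. Let A = (A_1,…,A_n) be an EF1 allocation, let w ∈ ℝ^{[n]×[n]} be the weight matrix w_{i,j} = v_i(A_j), let σ be a maximum weight permutation for w, and let p be the minimum subsidy vector for w with respect to σ. Then the allocation with subsidy in which agent i receives bundle A_{σ(i)} and subsidy p_{σ(i)} is envy-free, max_{i∈[n]} p_i ≤ n−1, and Σ_{i∈[n]} p_i ≤ n(n−1)/2. -/
/-- `p` lies in the polyhedron `P^σ` of envy-eliminating subsidy vectors for weight matrix `w`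
with respect to permutation `σ`. -/
def inP {n : ℕ} (w : Fin n → Fin n → ℝ) (σ : Equiv.Perm (Fin n)) (p : Fin n → ℝ) : Prop :=
  (∀ i, 0 ≤ p i) ∧ ∀ i j, w i j + p j ≤ w i (σ i) + p (σ i)

/-- `σ` is a maximum weight permutation for `w`. -/
def maxWeightPerm {n : ℕ} (w : Fin n → Fin n → ℝ) (σ : Equiv.Perm (Fin n)) : Prop :=
  ∀ τ : Equiv.Perm (Fin n), ∑ i, w i (τ i) ≤ ∑ i, w i (σ i)

/-- `p` is the minimum subsidy vector for `w` with respect to `σ`: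
the unique minimal element of `P^σ`. -/
def minSubsidyVec {n : ℕ} (w : Fin n → Fin n → ℝ) (σ : Equiv.Perm (Fin n))
    (p : Fin n → ℝ) : Prop :=
  inP w σ p ∧ ∀ p', inP w σ p' → ∀ i, p i ≤ p' i

/-- `A` is an ordered partition of the whole set of items. -/
def isPartition {n : ℕ} {M : Type*} [DecidableEq M] [Fintype M]
    (A : Fin n → Finset M) : Prop :=
  (∀ i j, i ≠ j → Disjoint (A i) (A j)) ∧ Finset.univ.biUnion A = Finset.univ

/-- The allocation `A` is envy-free up to `k` items for valuations `v`. -/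
def EFk {n : ℕ} {M : Type*} [DecidableEq M] (v : Fin n → Finset M → ℝ)
    (A : Fin n → Finset M) (k : ℕ) : Prop :=
  ∀ i j, ∃ X ⊆ A i ∪ A j, X.card ≤ k ∧ v i (A j \ X) ≤ v i (A i \ X)

open Finset Filter Topology in
/-- If a minimum subsidy vector is positive on a nonempty set `S`, then some envy constraint from
an agent assigned into `S` to a bundle outside `S` is tight. -/
theorem minSubsidyVec.exists_tight {n : ℕ} {w : Fin n → Fin n → ℝ} {σ : Equiv.Perm (Fin n)}
    {p : Fin n → ℝ} (hp : minSubsidyVec w σ p) {S : Finset (Fin n)} (hS : S.Nonempty)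
    (hpos : ∀ i ∈ S, 0 < p i) :
    ∃ i j, σ i ∈ S ∧ j ∉ S ∧ w i (σ i) + p (σ i) ≤ w i j + p j := by
  by_contra! h
  have hpos_ev : ∀ᶠ ε in 𝓝[>] (0 : ℝ), ∀ i, i ∈ S → ε ≤ p i :=
    eventually_all.2 fun i => eventually_imp_distrib_left.2 fun hi =>
      nhdsWithin_le_nhds (eventually_le_nhds (hpos i hi))
  have hslack_ev : ∀ᶠ ε in 𝓝[>] (0 : ℝ), ∀ i j, σ i ∈ S → j ∉ S →
      ε ≤ w i (σ i) + p (σ i) - (w i j + p j) :=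
    eventually_all.2 fun i => eventually_all.2 fun j => eventually_imp_distrib_left.2 fun hi =>
      eventually_imp_distrib_left.2 fun hj =>
        nhdsWithin_le_nhds (eventually_le_nhds (sub_pos.2 (h i j hi hj)))
  obtain ⟨ε, ⟨hεp, hεs⟩, hε : 0 < ε⟩ := ((hpos_ev.and hslack_ev).and self_mem_nhdsWithin).exists
  have hmem : inP w σ fun i => if i ∈ S then p i - ε else p i := by
    refine ⟨fun i => ?_, fun i j => ?_⟩
    · dsimp only
      split_ifs with hi
      · exact sub_nonneg.2 (hεp i hi)
      · exact hp.1.1 i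
    · have hij := hp.1.2 i j
      dsimp only
      split_ifs with hj hi hi
      · linarith
      · linarith
      · linarith [hεs i j hi hj]
      · exact hij
  obtain ⟨i, hi⟩ := hS
  have := hp.2 _ hmem i
  rw [if_pos hi] at this
  linarith

/-- If agent `i` envies any bundle relative to bundle `i` by at most one, then a minimum subsidy
vector that is positive on a nonempty set `S` exceeds its values off `S` by at most one
somewhere. -/
theorem minSubsidyVec.exists_le_add_one {n : ℕ} {w : Fin n → Fin n → ℝ}
    {σ : Equiv.Perm (Fin n)} {p : Fin n → ℝ} (hp : minSubsidyVec w σ p)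
    (hw : ∀ i j, w i j ≤ w i i + 1) {S : Finset (Fin n)} (hS : S.Nonempty)
    (hpos : ∀ i ∈ S, 0 < p i) : ∃ i ∈ S, ∃ j ∉ S, p i ≤ p j + 1 := by
  obtain ⟨i, j, hi, hj, hij⟩ := hp.exists_tight hS hpos
  by_cases hiS : i ∈ S
  · exact ⟨i, hiS, j, hj, by linarith [hp.1.2 i i, hw i j]⟩
  · obtain ⟨k, hk, hσk⟩ : ∃ k ∈ S, σ k ∉ S := by
      by_contra! h
      exact hiS (by simpa using Equiv.Perm.perm_symm_on_of_perm_on_finset h hi)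
    exact ⟨k, hk, σ k, hσk, by linarith [hp.1.2 k k, hw k (σ k)]⟩

/-- Under the hypotheses of `minSubsidyVec.exists_le_add_one`, the sorted subsidies are bounded
by `0, 1, …, n - 1`. -/
theorem minSubsidyVec.sort_le {n : ℕ} {w : Fin n → Fin n → ℝ}
    {σ : Equiv.Perm (Fin n)} {p : Fin n → ℝ} (hp : minSubsidyVec w σ p)
    (hw : ∀ i j, w i j ≤ w i i + 1) (k : Fin n) : p (Tuple.sort p k) ≤ (k : ℕ) := by
  have hmono : Monotone (p ∘ Tuple.sort p) := Tuple.monotone_sort p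
  induction k using WellFoundedLT.induction with
  | ind k ih =>
    rcases (hp.1.1 (Tuple.sort p k)).eq_or_lt with h0 | h0
    · rw [← h0]
      positivity
    · obtain ⟨a, ha, b, hb, hab⟩ := hp.exists_le_add_one hw
        (S := (Finset.Ici k).map (Tuple.sort p).toEmbedding) ⟨Tuple.sort p k, by simp⟩
        (by
          intro i hi
          obtain ⟨l, hl, rfl⟩ := Finset.mem_map.1 hi
          exact h0.trans_le (hmono (Finset.mem_Ici.1 hl)))
      obtain ⟨l, hl, rfl⟩ := Finset.mem_map.1 ha
      obtain ⟨m, rfl⟩ := (Tuple.sort p).surjective b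
      have hmk : m < k := by simpa using hb
      have hkl : p (Tuple.sort p k) ≤ p (Tuple.sort p l) := hmono (Finset.mem_Ici.1 hl)
      have hcast : ((m : ℕ) : ℝ) + 1 ≤ (k : ℕ) := by exact_mod_cast hmk
      have hm := ih m hmk
      simp only [Equiv.coe_toEmbedding] at hab
      linarith

/-- In an EF1 allocation with marginal bound one, every envy is at most one. -/
theorem EFk.le_add_one {n : ℕ} {M : Type*} [DecidableEq M] {v : Fin n → Finset M → ℝ}
    (hmb : ∀ (i : Fin n) (e : M) (X : Finset M), e ∉ X → |v i (insert e X) - v i X| ≤ 1)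
    {A : Fin n → Finset M} (hdisj : ∀ i j, i ≠ j → Disjoint (A i) (A j)) (h : EFk v A 1)
    (i j : Fin n) : v i (A j) ≤ v i (A i) + 1 := by
  have herase : ∀ (e : M) (Y : Finset M), e ∈ Y → |v i Y - v i (Y \ {e})| ≤ 1 := by
    intro e Y he
    have := hmb i e (Y \ {e}) (by simp)
    rwa [Finset.insert_sdiff_self_of_mem he] at this
  rcases eq_or_ne i j with rfl | hij
  · linarith
  obtain ⟨X, hX, hcard, hle⟩ := h i j
  rcases X.eq_empty_or_nonempty with rfl | hne
  · simp only [Finset.sdiff_empty] at hle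
    linarith
  · obtain ⟨e, rfl⟩ := Finset.card_eq_one.1 (hcard.antisymm hne.card_pos)
    rcases Finset.mem_union.1 (Finset.singleton_subset_iff.1 hX) with he | he
    · have hej := Finset.disjoint_left.1 (hdisj i j hij) he
      rw [Finset.sdiff_eq_self_of_disjoint (Finset.disjoint_singleton_right.2 hej)] at hle
      linarith [(abs_le.1 (herase e _ he)).1]
    · have hei := Finset.disjoint_right.1 (hdisj i j hij) he
      rw [Finset.sdiff_eq_self_of_disjoint (Finset.disjoint_singleton_right.2 hei)] at hle
      linarith [(abs_le.1 (herase e _ he)).2]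

theorem EF1_min_subsidy_bounds {n : ℕ} (hn : 1 ≤ n) {M : Type*} [DecidableEq M] [Fintype M]
    (v : Fin n → Finset M → ℝ)
    (hmb : ∀ (i : Fin n) (e : M) (X : Finset M), e ∉ X → |v i (insert e X) - v i X| ≤ 1)
    (A : Fin n → Finset M) (hpart : isPartition A)
    (hEF1 : EFk v A 1)
    (w : Fin n → Fin n → ℝ) (hw : ∀ i j, w i j = v i (A j))
    (σ : Equiv.Perm (Fin n)) (hσ : maxWeightPerm w σ)
    (p : Fin n → ℝ) (hp : minSubsidyVec w σ p) :
    (∀ i j : Fin n, v i (A (σ j)) + p (σ j) ≤ v i (A (σ i)) + p (σ i)) ∧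
    (∀ i, p i ≤ (n : ℝ) - 1) ∧
    (∑ i, p i ≤ (n : ℝ) * ((n : ℝ) - 1) / 2) := by
  have hw1 : ∀ i j, w i j ≤ w i i + 1 := fun i j => by
    simpa only [hw] using hEF1.le_add_one hmb hpart.1 i j
  refine ⟨fun i j => by simpa only [hw] using hp.1.2 i (σ j), fun i => ?_, ?_⟩
  · obtain ⟨k, rfl⟩ := (Tuple.sort p).surjective i
    have hk : ((k : ℕ) : ℝ) + 1 ≤ n := by exact_mod_cast k.isLt
    linarith [hp.sort_le hw1 k]
  · rw [← Equiv.sum_comp (Tuple.sort p) p]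
    refine (Finset.sum_le_sum fun k _ => hp.sort_le hw1 k).trans_eq ?_
    rw [Fin.sum_univ_eq_sum_range (fun k => (k : ℝ)) n, ← Nat.cast_sum, eq_div_iff two_ne_zero,
      ← Nat.cast_pred hn]
    exact_mod_cast Finset.sum_range_id_mul_two n
end

section
/- If every item is either a good or a chore for every agent (doubly monotone valuations) and every valuation has marginal bound 1, then there exists an allocation A and a subsidy vector p such that (A,p) is envy-free, max_{i∈[n]} p_i ≤ n−1, and Σ_{i∈[n]} p_i ≤ n(n−1)/2. -/
/-- A self-map of a nonempty finite set permutes some nonempty subset. -/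
theorem exists_perm_eq_on_subset {ι : Type*} [Finite ι] (V : Finset ι) (hV : V.Nonempty)
    (g : ι → ι) (hg : ∀ x ∈ V, g x ∈ V) :
    ∃ (C : Finset ι) (π : Equiv.Perm ι), C ⊆ V ∧ C.Nonempty ∧
      (∀ x ∈ C, π x = g x) ∧ ∀ x ∉ C, π x = x := by
  classical
  obtain ⟨C, hC, hmin⟩ := Finset.exists_min_image
    (V.powerset.filter fun C => C.Nonempty ∧ ∀ x ∈ C, g x ∈ C) Finset.card
    ⟨V, by simp [hV]; exact hg⟩
  simp only [Finset.mem_filter, Finset.mem_powerset] at hC hmin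
  obtain ⟨hCV, hCne, hCg⟩ := hC
  have himg : C.image g ⊆ C := Finset.image_subset_iff.2 hCg
  have hcard : C.card ≤ (C.image g).card := by
    refine hmin _ ⟨himg.trans hCV, hCne.image g, fun x hx => ?_⟩
    exact Finset.mem_image_of_mem g (himg hx)
  have hinj : Set.InjOn g C :=
    Finset.card_image_iff.1 (le_antisymm Finset.card_image_le hcard)
  have hbij : Function.Bijective fun x => if x ∈ C then g x else x := by
    apply Finite.injective_iff_bijective.1
    intro x y hxy
    by_cases hx : x ∈ C <;> by_cases hy : y ∈ C <;> simp only [hx, hy, if_true, if_false] at hxy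
    · exact hinj hx hy hxy
    · exact absurd (hxy ▸ hCg x hx) hy
    · exact absurd (hxy ▸ hCg y hy) hx
    · exact hxy
  exact ⟨C, Equiv.ofBijective _ hbij, hCV, hCne, fun x hx => by simp [hx], fun x hx => by simp [hx]⟩

/-- Bundles of an allocation with envy at most one can be permuted, keeping that property, so that
some agent of `V` is not envied by any agent of `V`. -/
theorem exists_perm_unenvied {ι : Type*} [Fintype ι] (w : ι → ι → ℝ)
    (hw : ∀ i j, w i j ≤ w i i + 1) (V : Finset ι) (hV : V.Nonempty) :
    ∃ σ : Equiv.Perm ι, (∀ i j, w i j ≤ w i (σ i) + 1) ∧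
      ∃ i ∈ V, ∀ j ∈ V, w j (σ i) ≤ w j (σ j) := by
  classical
  obtain ⟨σ, hσ, hmax⟩ := Finset.exists_max_image
    (Finset.univ.filter fun σ : Equiv.Perm ι => ∀ i j, w i j ≤ w i (σ i) + 1)
    (fun σ => ∑ i, w i (σ i)) ⟨1, by simpa using hw⟩
  simp only [Finset.mem_filter, Finset.mem_univ, true_and] at hσ hmax
  refine ⟨σ, hσ, ?_⟩
  by_contra! hcon
  choose! g hgV hg using hcon
  obtain ⟨C, π, hCV, ⟨c, hc⟩, hπC, hπ⟩ := exists_perm_eq_on_subset V hV g hgV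
  have himp : ∀ x, w (π x) (σ (π x)) ≤ w (π x) (σ x) := by
    intro x
    by_cases hx : x ∈ C
    · rw [hπC x hx]; exact (hg x (hCV hx)).le
    · rw [hπ x hx]
  have hle := hmax (π.symm.trans σ) fun i j => by
    have := himp (π.symm i)
    simp only [Equiv.apply_symm_apply] at this
    simp only [Equiv.trans_apply]
    linarith [hσ i j]
  rw [← Equiv.sum_comp π, ← Equiv.sum_comp π (fun i => w i (σ i))] at hle
  simp only [Equiv.trans_apply, Equiv.symm_apply_apply] at hle
  refine hle.not_gt (Finset.sum_lt_sum (fun x _ => himp x) ⟨c, Finset.mem_univ c, ?_⟩)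
  rw [hπC c hc]
  exact hg c (hCV hc)

/-- Bundles of an allocation with envy at most one can be permuted, keeping that property, so that
some agent envies nobody. -/
theorem exists_perm_unenvious {ι : Type*} [Fintype ι] [Nonempty ι] (w : ι → ι → ℝ)
    (hw : ∀ i j, w i j ≤ w i i + 1) :
    ∃ σ : Equiv.Perm ι, (∀ i j, w i j ≤ w i (σ i) + 1) ∧ ∃ i, ∀ j, w i j ≤ w i (σ i) := by
  choose g hg using fun i => Finite.exists_max (w i)
  obtain ⟨C, π, -, ⟨c, hc⟩, hπC, hπ⟩ :=
    exists_perm_eq_on_subset Finset.univ Finset.univ_nonempty g (by simp)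
  refine ⟨π, fun i j => ?_, c, fun j => ?_⟩
  · by_cases hi : i ∈ C
    · rw [hπC i hi]; linarith [hg i j]
    · rw [hπ i hi]; exact hw i j
  · rw [hπC c hc]; exact hg c j

/-- Disjoint bundles stay disjoint and cover one more item when that item is given to one agent. -/
theorem partition_update_insert {ι M : Type*} [Fintype ι] [DecidableEq ι] [DecidableEq M]
    {A : ι → Finset M} {s : Finset M} {e : M} (he : e ∉ s)
    (hdisj : ∀ i j, i ≠ j → Disjoint (A i) (A j)) (hcov : Finset.univ.biUnion A = s) (k : ι) :
    (∀ i j, i ≠ j → Disjoint (Function.update A k (insert e (A k)) i)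
      (Function.update A k (insert e (A k)) j)) ∧
    Finset.univ.biUnion (Function.update A k (insert e (A k))) = insert e s := by
  have heA : ∀ i, e ∉ A i := fun i hi =>
    he (hcov ▸ Finset.mem_biUnion.2 ⟨i, Finset.mem_univ i, hi⟩)
  constructor
  · intro i j hij
    rcases eq_or_ne i k with rfl | hi
    · rw [Function.update_self, Function.update_of_ne hij.symm, Finset.disjoint_insert_left]
      exact ⟨heA j, hdisj i j hij⟩
    · rw [Function.update_of_ne hi]
      rcases eq_or_ne j k with rfl | hj
      · rw [Function.update_self, Finset.disjoint_insert_right]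
        exact ⟨heA i, hdisj i j hij⟩
      · rw [Function.update_of_ne hj]
        exact hdisj i j hij
  · ext x
    subst hcov
    simp only [Finset.mem_biUnion, Finset.mem_univ, true_and, Finset.mem_insert]
    constructor
    · rintro ⟨i, hi⟩
      rcases eq_or_ne i k with rfl | hik
      · rw [Function.update_self, Finset.mem_insert] at hi
        exact hi.imp_right fun h => ⟨i, h⟩
      · rw [Function.update_of_ne hik] at hi
        exact Or.inr ⟨i, hi⟩
    · rintro (rfl | ⟨i, hi⟩)
      · exact ⟨k, by simp⟩
      · refine ⟨i, ?_⟩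
        rcases eq_or_ne i k with rfl | hik
        · simp [hi]
        · rwa [Function.update_of_ne hik]

theorem partition_comp_perm {ι M : Type*} [Fintype ι] [DecidableEq M]
    {A : ι → Finset M} {s : Finset M} (hdisj : ∀ i j, i ≠ j → Disjoint (A i) (A j))
    (hcov : Finset.univ.biUnion A = s) (σ : Equiv.Perm ι) :
    (∀ i j, i ≠ j → Disjoint (A (σ i)) (A (σ j))) ∧
    Finset.univ.biUnion (fun i => A (σ i)) = s := by
  refine ⟨fun i j hij => hdisj _ _ (σ.injective.ne hij), ?_⟩
  rw [← hcov]
  ext x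
  simp only [Finset.mem_biUnion, Finset.mem_univ, true_and]
  exact σ.exists_congr_left.trans (by simp)

/-- Doubly monotone valuations with marginals bounded by one admit allocations in which
every envy is at most one. -/
theorem exists_allocation_envy_le_one {ι M : Type*} [Fintype ι] [Nonempty ι] [DecidableEq M]
    (v : ι → Finset M → ℝ)
    (hmb : ∀ (i : ι) (e : M) (X : Finset M), e ∉ X → |v i (insert e X) - v i X| ≤ 1)
    (hdm : ∀ (i : ι) (e : M),
      (∀ X : Finset M, e ∉ X → v i X ≤ v i (insert e X)) ∨
      (∀ X : Finset M, e ∉ X → v i (insert e X) ≤ v i X)) (s : Finset M) :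
    ∃ A : ι → Finset M, (∀ i j, i ≠ j → Disjoint (A i) (A j)) ∧ Finset.univ.biUnion A = s ∧
      ∀ i j, v i (A j) ≤ v i (A i) + 1 := by
  classical
  induction s using Finset.induction_on with
  | empty => exact ⟨fun _ => ∅, by simp, by ext; simp, by simp⟩
  | insert e s he ih =>
    obtain ⟨A₀, hdisj₀, hcov₀, hA₀⟩ := ih
    suffices h : ∃ (σ : Equiv.Perm ι) (k : ι), ∀ i j,
        v i (Function.update (fun i => A₀ (σ i)) k (insert e (A₀ (σ k))) j) ≤
        v i (Function.update (fun i => A₀ (σ i)) k (insert e (A₀ (σ k))) i) + 1 by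
      obtain ⟨σ, k, h⟩ := h
      obtain ⟨hdisj, hcov⟩ := partition_comp_perm hdisj₀ hcov₀ σ
      obtain ⟨hdisj', hcov'⟩ := partition_update_insert he hdisj hcov k
      exact ⟨_, hdisj', hcov', h⟩
    have heA : ∀ i, e ∉ A₀ i := fun i hi =>
      he (hcov₀ ▸ Finset.mem_biUnion.2 ⟨i, Finset.mem_univ i, hi⟩)
    have habs : ∀ i b, v i (insert e (A₀ b)) ≤ v i (A₀ b) + 1 ∧
        v i (A₀ b) - 1 ≤ v i (insert e (A₀ b)) := fun i b => by
      have := abs_le.1 (hmb i e (A₀ b) (heA b))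
      constructor <;> linarith
    set V : Finset ι := Finset.univ.filter fun i =>
      ∀ X : Finset M, e ∉ X → v i X ≤ v i (insert e X)
    have hgood : ∀ i ∈ V, ∀ b, v i (A₀ b) ≤ v i (insert e (A₀ b)) := fun i hi b =>
      (Finset.mem_filter.1 hi).2 _ (heA b)
    have hchore : ∀ i ∉ V, ∀ b, v i (insert e (A₀ b)) ≤ v i (A₀ b) := fun i hi b =>
      (hdm i e).resolve_left (fun h => hi (Finset.mem_filter.2 ⟨Finset.mem_univ i, h⟩)) _ (heA b)
    rcases V.eq_empty_or_nonempty with hV | hV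
    · obtain ⟨σ, hσ, k, hk⟩ := exists_perm_unenvious (fun i j => v i (A₀ j)) hA₀
      refine ⟨σ, k, fun i j => ?_⟩
      have hown := (habs i (σ k)).2
      have hless := hchore i (by simp [hV]) (σ k)
      rcases eq_or_ne i k with rfl | hi <;> rcases eq_or_ne j i with rfl | hji
      · linarith
      · rw [Function.update_of_ne hji, Function.update_self]
        linarith [hk (σ j)]
      · linarith
      · rw [Function.update_of_ne hi]
        rcases eq_or_ne j k with rfl | hj
        · rw [Function.update_self]; linarith [hσ i (σ j)]
        · rw [Function.update_of_ne hj]; exact hσ i (σ j)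
    · obtain ⟨σ, hσ, k, hkV, hk⟩ := exists_perm_unenvied (fun i j => v i (A₀ j)) hA₀ V hV
      refine ⟨σ, k, fun i j => ?_⟩
      rcases eq_or_ne j i with rfl | hji
      · linarith
      rcases eq_or_ne i k with rfl | hi
      · rw [Function.update_of_ne hji, Function.update_self]
        linarith [hσ i (σ j), hgood i hkV (σ i)]
      · rw [Function.update_of_ne hi]
        rcases eq_or_ne j k with rfl | hj
        · rw [Function.update_self]
          by_cases hiV : i ∈ V
          · linarith [hk i hiV, (habs i (σ j)).1]
          · linarith [hchore i hiV (σ j), hσ i (σ j)]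
        · rw [Function.update_of_ne hj]; exact hσ i (σ j)

/-- If every nonempty set `S` has an element whose value is nonpositive or at most one more than
some value outside `S`, then in increasing order the values are bounded by `0, 1, 2, …`. -/
theorem bounds_of_gaps_le_one {ι : Type*} [Fintype ι] (p : ι → ℝ)
    (hgap : ∀ S : Finset ι, S.Nonempty → ∃ b ∈ S, p b ≤ 0 ∨ ∃ c ∉ S, p b ≤ p c + 1) :
    (∀ b, p b ≤ (Fintype.card ι : ℝ) - 1) ∧
      ∑ b, p b ≤ (Fintype.card ι : ℝ) * ((Fintype.card ι : ℝ) - 1) / 2 := by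
  classical
  have key : ∀ k : ℕ, k ≤ Fintype.card ι → ∃ U : Finset ι, U.card = k ∧
      (∀ b ∈ U, p b ≤ (k : ℝ) - 1) ∧ ∑ b ∈ U, p b ≤ (k : ℝ) * ((k : ℝ) - 1) / 2 := by
    intro k
    induction k with
    | zero => exact fun _ => ⟨∅, by simp⟩
    | succ k ih =>
      intro hk
      obtain ⟨U, hcard, hU, hsum⟩ := ih (by omega)
      have hne : Uᶜ.Nonempty := by
        rw [← Finset.card_pos, Finset.card_compl]; omega
      obtain ⟨b, hb, hpb⟩ := hgap Uᶜ hne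
      have hbU : b ∉ U := Finset.mem_compl.1 hb
      have hbk : p b ≤ k := by
        rcases hpb with h | ⟨c, hc, h⟩
        · exact h.trans k.cast_nonneg
        · linarith [hU c (by simpa using hc)]
      refine ⟨insert b U, by rw [Finset.card_insert_of_notMem hbU, hcard], ?_, ?_⟩
      · intro x hx
        push_cast
        rcases Finset.mem_insert.1 hx with rfl | hx
        · linarith
        · linarith [hU x hx]
      · rw [Finset.sum_insert hbU]
        push_cast
        nlinarith
  obtain ⟨U, hcard, hU, hsum⟩ := key _ le_rfl
  obtain rfl := Finset.card_eq_iff_eq_univ U |>.1 hcard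
  exact ⟨fun b => hU b (Finset.mem_univ b), hsum⟩

theorem exists_pos_le_of_finite {α : Type*} [Finite α] (f : α → ℝ) (hf : ∀ a, 0 < f a) :
    ∃ ε > 0, ∀ a, ε ≤ f a := by
  cases isEmpty_or_nonempty α
  · exact ⟨1, one_pos, fun a => isEmptyElim a⟩
  · obtain ⟨a, ha⟩ := Finite.exists_min f
    exact ⟨f a, hf a, ha⟩

/-- If the assignment `i ↦ i` leaves envy at most one, then some reassignment of the bundles admits
envy-eliminating subsidies that are bounded by `0, 1, 2, …` in increasing order. -/
theorem exists_reassignment_subsidy {ι : Type*} [Fintype ι] (w : ι → ι → ℝ)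
    (hw : ∀ i j, w i j ≤ w i i + 1) :
    ∃ (σ : Equiv.Perm ι) (p : ι → ℝ), (∀ b, 0 ≤ p b) ∧
      (∀ i b, w i b + p b ≤ w i (σ i) + p (σ i)) ∧
      (∀ b, p b ≤ (Fintype.card ι : ℝ) - 1) ∧
      ∑ b, p b ≤ (Fintype.card ι : ℝ) * ((Fintype.card ι : ℝ) - 1) / 2 := by
  classical
  set n : ℝ := (Fintype.card ι : ℝ)
  have hn0 : 0 ≤ n := Nat.cast_nonneg _
  -- `u p i` is the best utility available to agent `i` at prices `p`.
  let u : (ι → ℝ) → ι → ℝ := fun p i => Finset.univ.sup' ⟨i, Finset.mem_univ i⟩ fun b => w i b + p b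
  have hu : ∀ p i b, w i b + p b ≤ u p i := fun p i b =>
    Finset.le_sup' (fun b => w i b + p b) (Finset.mem_univ b)
  have hu_le : ∀ p i x, (∀ b, w i b + p b ≤ x) → u p i ≤ x := fun p i x h =>
    Finset.sup'_le _ _ fun b _ => h b
  have hu_cont : ∀ i, Continuous fun p => u p i := fun i =>
    Continuous.finset_sup'_apply _ fun b _ => by fun_prop
  -- The dual objective, perturbed so that its minimizer has no slack.
  let F : (ι → ℝ) → ℝ := fun p => ∑ i, u p i - n / (n + 1) * ∑ b, p b
  have hF : Continuous F := by
    have := continuous_finsetSum Finset.univ fun i _ => hu_cont i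
    fun_prop
  obtain ⟨p, hp, hmin⟩ := (isCompact_Icc (a := fun _ : ι => (0 : ℝ)) (b := fun _ => n)).exists_isMinOn
    ⟨fun _ => 0, le_rfl, fun _ => hn0⟩ hF.continuousOn
  have hp0 : ∀ b, 0 ≤ p b := hp.1
  have hcoef : n / (n + 1) < 1 := by rw [div_lt_one] <;> linarith
  have hgap : ∀ S : Finset ι, S.Nonempty → ∃ b ∈ S, p b ≤ 0 ∨ ∃ c ∉ S, p b ≤ p c + 1 := by
    intro S hS
    by_contra! hcon
    obtain ⟨ε₁, hε₁, h₁⟩ := exists_pos_le_of_finite (fun b : S => p b)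
      fun b => (hcon b b.2).1
    obtain ⟨ε₂, hε₂, h₂⟩ := exists_pos_le_of_finite
      (fun x : S × (Sᶜ : Finset ι) => p x.1 - (p x.2 + 1))
      fun x => sub_pos.2 ((hcon x.1 x.1.2).2 x.2 (Finset.mem_compl.1 x.2.2))
    obtain ⟨ε, hε, hle₁, hle₂⟩ : ∃ ε > 0, ε ≤ ε₁ ∧ ε ≤ ε₂ :=
      ⟨min ε₁ ε₂, lt_min hε₁ hε₂, min_le_left _ _, min_le_right _ _⟩
    have hlt : F (fun b => p b - if b ∈ S then ε else 0) < F p := by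
      have hsum : ∑ i, u (fun b => p b - if b ∈ S then ε else 0) i ≤
          ∑ i, (u p i - if i ∈ S then ε else 0) := by
        refine Finset.sum_le_sum fun i _ => hu_le _ _ _ fun b => ?_
        have hb := hu p i b
        by_cases hi : i ∈ S <;> by_cases hbS : b ∈ S <;> simp only [hi, hbS, if_true, if_false]
        · linarith
        · have := h₂ (⟨i, hi⟩, ⟨b, Finset.mem_compl.2 hbS⟩)
          simp only at this
          linarith [hw i b, hu p i i]
        · linarith
        · linarith
      have hεS : ∑ i, (if i ∈ S then ε else 0) = S.card * ε := by simp
      have hpos : 0 < S.card * ε := mul_pos (Nat.cast_pos.2 hS.card_pos) hε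
      simp only [F, Finset.sum_sub_distrib, hεS] at hsum ⊢
      nlinarith
    refine hlt.not_ge (hmin ⟨fun b => ?_, fun b => ?_⟩)
    · by_cases hb : b ∈ S
      · have := h₁ ⟨b, hb⟩
        simp only [hb, if_true]
        simp only at this
        linarith
      · simpa [hb] using hp0 b
    · have := hp.2 b
      simp only at this ⊢
      split_ifs <;> linarith
  obtain ⟨hmax, htotal⟩ := bounds_of_gaps_le_one p hgap
  let N : ι → Finset ι := fun i => Finset.univ.filter fun b => w i b + p b = u p i
  have hall : ∀ T : Finset ι, T.card ≤ (T.biUnion N).card := by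
    intro T
    by_contra! hcon
    obtain ⟨ε₁, hε₁, h₁⟩ := exists_pos_le_of_finite
      (fun x : T × ((T.biUnion N)ᶜ : Finset ι) => u p x.1 - (w x.1 x.2 + p x.2))
      (fun x => sub_pos.2 ((hu p x.1 x.2).lt_of_ne fun h => Finset.mem_compl.1 x.2.2
        (Finset.mem_biUnion.2 ⟨x.1, x.1.2, Finset.mem_filter.2 ⟨Finset.mem_univ _, h⟩⟩)))
    obtain ⟨ε, hε, hle₁, hle⟩ : ∃ ε > 0, ε ≤ ε₁ ∧ ε ≤ 1 :=
      ⟨min ε₁ 1, lt_min hε₁ one_pos, min_le_left _ _, min_le_right _ _⟩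
    have hlt : F (fun b => p b + if b ∈ (T.biUnion N)ᶜ then ε else 0) < F p := by
      have hsum : ∑ i, u (fun b => p b + if b ∈ (T.biUnion N)ᶜ then ε else 0) i ≤
          ∑ i, (u p i + if i ∈ Tᶜ then ε else 0) := by
        refine Finset.sum_le_sum fun i _ => hu_le _ _ _ fun b => ?_
        have hb := hu p i b
        by_cases hi : i ∈ Tᶜ <;> by_cases hbN : b ∈ (T.biUnion N)ᶜ <;>
          simp only [hi, hbN, if_true, if_false]
        · linarith
        · linarith
        · have := h₁ (⟨i, by simpa using hi⟩, ⟨b, hbN⟩)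
          simp only at this
          linarith
        · linarith
      have hεs : ∀ S : Finset ι, ∑ i, (if i ∈ Sᶜ then ε else 0) = (n - S.card) * ε := fun S => by
        rw [← Finset.sum_filter, Finset.filter_mem_eq_inter, Finset.univ_inter, Finset.sum_const,
          Finset.card_compl, nsmul_eq_mul, Nat.cast_sub (Finset.card_le_univ S)]
      have hcard : ((T.biUnion N).card : ℝ) + 1 ≤ T.card := by exact_mod_cast hcon
      have hT : (n - T.card) < n / (n + 1) * (n - (T.biUnion N).card) := by
        rw [div_mul_eq_mul_div, lt_div_iff₀ (by linarith)]
        nlinarith [Nat.cast_nonneg (α := ℝ) (T.biUnion N).card]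
      have := mul_lt_mul_of_pos_right hT hε
      simp only [F, Finset.sum_add_distrib, hεs] at hsum ⊢
      nlinarith
    refine hlt.not_ge (hmin ⟨fun b => ?_, fun b => ?_⟩)
    · have := hp0 b
      simp only
      split_ifs <;> linarith
    · have := hmax b
      simp only
      split_ifs <;> linarith
  obtain ⟨f, hf, hfN⟩ := (Finset.all_card_le_biUnion_card_iff_exists_injective N).1 hall
  refine ⟨Equiv.ofBijective f (Finite.injective_iff_bijective.1 hf), p, hp0, fun i b => ?_,
    hmax, htotal⟩
  rw [Equiv.ofBijective_apply, (Finset.mem_filter.1 (hfN i)).2]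
  exact hu p i b


/-- The allocation with subsidy `(A, p)` is envy-free. -/
def envyFree {n : ℕ} {M : Type*} (v : Fin n → Finset M → ℝ)
    (A : Fin n → Finset M) (p : Fin n → ℝ) : Prop :=
  ∀ i j, v i (A j) + p j ≤ v i (A i) + p i

theorem doubly_monotone_envy_free_subsidy {n : ℕ} (hn : 1 ≤ n)
    {M : Type*} [DecidableEq M] [Fintype M]
    (v : Fin n → Finset M → ℝ)
    (hmb : ∀ (i : Fin n) (e : M) (X : Finset M), e ∉ X → |v i (insert e X) - v i X| ≤ 1)
    (hdm : ∀ (i : Fin n) (e : M),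
      (∀ X : Finset M, e ∉ X → v i X ≤ v i (insert e X)) ∨
      (∀ X : Finset M, e ∉ X → v i (insert e X) ≤ v i X)) :
    ∃ (A : Fin n → Finset M) (p : Fin n → ℝ),
      isPartition A ∧ (∀ i, 0 ≤ p i) ∧ envyFree v A p ∧
      (∀ i, p i ≤ (n : ℝ) - 1) ∧ ∑ i, p i ≤ (n : ℝ) * ((n : ℝ) - 1) / 2 := by
  have : Nonempty (Fin n) := ⟨⟨0, hn⟩⟩
  obtain ⟨A, hdisj, hcov, hA⟩ := exists_allocation_envy_le_one v hmb hdm Finset.univ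
  obtain ⟨σ, p, hp, henvy, hmax, hsum⟩ := exists_reassignment_subsidy (fun i j => v i (A j)) hA
  rw [Fintype.card_fin] at hmax hsum
  refine ⟨fun i => A (σ i), fun i => p (σ i), partition_comp_perm hdisj hcov σ, fun i => hp _,
    fun i j => henvy i (σ j), fun i => hmax _, ?_⟩
  rwa [Equiv.sum_comp σ p]
end

section
/- If n = 2 and each of the two agents has a valuation with marginal bound 1 (valuations otherwise arbitrary), then there exists an allocation A = (A_1,A_2) and a subsidy vector p = (p_1,p_2) such that (A,p) is envy-free, max{p_1,p_2} ≤ 1, and p_1 + p_2 ≤ 1. -/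
/-- A complement-antisymmetric set function whose value changes by at most `2` when one element is
inserted takes a value in `[-1, 1]`. -/
theorem exists_abs_le_one_of_compl_eq_neg {M : Type*} [DecidableEq M] [Fintype M]
    (f : Finset M → ℝ) (hneg : ∀ X, f Xᶜ = -f X)
    (hstep : ∀ e X, e ∉ X → |f (insert e X) - f X| ≤ 2) : ∃ X, |f X| ≤ 1 := by
  by_contra! h
  have hsign : ∀ X, 0 < f X ↔ 0 < f ∅ := by
    intro X
    induction X using Finset.induction_on with
    | empty => rfl
    | insert e X he ih =>
      rw [← ih]
      have hs := abs_le.1 (hstep e X he)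
      rcases lt_abs.1 (h X) with h1 | h1 <;> rcases lt_abs.1 (h (insert e X)) with h2 | h2 <;>
        constructor <;> intro h3 <;> linarith
  have hc := hneg ∅
  have hu := hsign ∅ᶜ
  rcases lt_abs.1 (h ∅) with h1 | h1
  · linarith [hu.2 (by linarith)]
  · linarith [hu.1 (by linarith)]

/-- Under marginal bound `1`, some bundle and its complement differ in value by at most `1`. -/
theorem exists_abs_sub_compl_le_one {M : Type*} [DecidableEq M] [Fintype M]
    (u : Finset M → ℝ) (hu : ∀ e X, e ∉ X → |u (insert e X) - u X| ≤ 1) :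
    ∃ X, |u X - u Xᶜ| ≤ 1 := by
  refine exists_abs_le_one_of_compl_eq_neg (fun X => u X - u Xᶜ) (fun X => ?_) fun e X he => ?_
  · simp
  · have h1 := abs_le.1 (hu e X he)
    have h2 := abs_le.1 (hu e (insert e X)ᶜ (by simp))
    rw [Finset.insert_compl_insert he] at h2
    rw [abs_le]
    constructor <;> linarith

theorem isPartition_compl {M : Type*} [DecidableEq M] [Fintype M] (X : Finset M) :
    isPartition ![X, Xᶜ] := by
  constructor
  · intro i j hij
    fin_cases i <;> fin_cases j <;> simp_all [disjoint_compl_right, disjoint_compl_left]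
  · ext e
    simp [Fin.exists_fin_two, em]

theorem two_agents_envy_free_subsidy {M : Type*} [DecidableEq M] [Fintype M]
    (v : Fin 2 → Finset M → ℝ)
    (hmb : ∀ (i : Fin 2) (e : M) (X : Finset M), e ∉ X → |v i (insert e X) - v i X| ≤ 1) :
    ∃ (A : Fin 2 → Finset M) (p : Fin 2 → ℝ),
      isPartition A ∧ (∀ i, 0 ≤ p i) ∧ envyFree v A p ∧
      max (p 0) (p 1) ≤ 1 ∧ p 0 + p 1 ≤ 1 := by
  obtain ⟨X, hX, hle⟩ : ∃ X, |v 0 X - v 0 Xᶜ| ≤ 1 ∧ v 1 X - v 1 Xᶜ ≤ v 0 X - v 0 Xᶜ := by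
    obtain ⟨X, hX⟩ := exists_abs_sub_compl_le_one (v 0) (hmb 0)
    rcases le_total (v 1 X - v 1 Xᶜ) (v 0 X - v 0 Xᶜ) with h | h
    · exact ⟨X, hX, h⟩
    · refine ⟨Xᶜ, ?_, ?_⟩ <;> rw [compl_compl]
      · rwa [abs_sub_comm]
      · linarith
  rw [abs_le] at hX
  rcases le_total 0 (v 0 X - v 0 Xᶜ) with h | h
  · refine ⟨![X, Xᶜ], ![0, v 0 X - v 0 Xᶜ], isPartition_compl X, ?_, ?_, ?_, ?_⟩ <;>
      simp [envyFree, Fin.forall_fin_two] <;> linarith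
  · refine ⟨![X, Xᶜ], ![v 0 Xᶜ - v 0 X, 0], isPartition_compl X, ?_, ?_, ?_, ?_⟩ <;>
      simp [envyFree, Fin.forall_fin_two] <;> linarith
end

section
/- Let k ≥ 1 and let each agent have a valuation with marginal bound 1. Let A = (A_1,…,A_n) be an EFk allocation, let w_{i,j} = v_i(A_j), let σ be a maximum weight permutation for w, and let p be the minimum subsidy vector for w with respect to σ. Then giving agent i the bundle A_{σ(i)} and subsidy p_{σ(i)} is envy-free, max_{i∈[n]} p_i ≤ k(n−1), and Σ_{i∈[n]} p_i ≤ k·n(n−1)/2. -/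
/-- A set function with marginals bounded by `1` changes by at most the number of added items. -/
lemma abs_union_sub_le_card {M : Type*} [DecidableEq M] {f : Finset M → ℝ}
    (hf : ∀ (e : M) (X : Finset M), e ∉ X → |f (insert e X) - f X| ≤ 1)
    (S T : Finset M) (hST : Disjoint S T) : |f (S ∪ T) - f S| ≤ T.card := by
  induction T using Finset.induction_on with
  | empty => simp
  | insert a T ha ih =>
    rw [Finset.disjoint_insert_right] at hST
    have h1 := ih hST.2
    have h2 := hf a (S ∪ T) (by simp [ha, hST.1])
    rw [Finset.union_insert, Finset.card_insert_of_notMem ha]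
    push_cast
    rw [abs_le] at *
    constructor <;> linarith [h1.1, h1.2, h2.1, h2.2]

lemma abs_sub_sdiff_le_card_inter {M : Type*} [DecidableEq M] {f : Finset M → ℝ}
    (hf : ∀ (e : M) (X : Finset M), e ∉ X → |f (insert e X) - f X| ≤ 1)
    (Y X : Finset M) : |f Y - f (Y \ X)| ≤ (Y ∩ X).card := by
  have h := abs_union_sub_le_card hf (Y \ X) (Y ∩ X) (Finset.disjoint_sdiff_inter Y X)
  rwa [Finset.sdiff_union_inter] at h

/-- In an EFk allocation the envy between any two agents is at most `k`. -/
lemma EFk.value_le_add {n : ℕ} {M : Type*} [DecidableEq M] {v : Fin n → Finset M → ℝ}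
    (hmb : ∀ (i : Fin n) (e : M) (X : Finset M), e ∉ X → |v i (insert e X) - v i X| ≤ 1)
    {A : Fin n → Finset M} (hA : ∀ i j, i ≠ j → Disjoint (A i) (A j)) {k : ℕ}
    (h : EFk v A k) (i j : Fin n) : v i (A j) ≤ v i (A i) + k := by
  rcases eq_or_ne i j with rfl | hij
  · simp
  obtain ⟨X, -, hXk, hX⟩ := h i j
  have h1 := abs_le.1 (abs_sub_sdiff_le_card_inter (hmb i) (A i) X)
  have h2 := abs_le.1 (abs_sub_sdiff_le_card_inter (hmb i) (A j) X)
  have h3 : (A i ∩ X).card + (A j ∩ X).card ≤ k := by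
    rw [← Finset.card_union_of_disjoint
      ((hA i j hij).mono Finset.inter_subset_left Finset.inter_subset_left)]
    exact (Finset.card_le_card
      (Finset.union_subset Finset.inter_subset_right Finset.inter_subset_right)).trans hXk
  have h4 : ((A i ∩ X).card : ℝ) + (A j ∩ X).card ≤ k := by exact_mod_cast h3
  linarith [h1.1, h2.2]

/-- If no envy in `w` exceeds `c`, then consecutive values of the minimum subsidy vector
differ by at most `c`. -/
lemma minSubsidyVec.exists_lt_le_add {n : ℕ} {w : Fin n → Fin n → ℝ}
    {σ : Equiv.Perm (Fin n)} {p : Fin n → ℝ} (hp : minSubsidyVec w σ p) {c : ℝ}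
    (hw : ∀ i j, w i j ≤ w i i + c) {j : Fin n} (hj : 0 < p j) :
    ∃ l, p l < p j ∧ p j ≤ p l + c := by
  by_contra! hgap
  obtain ⟨⟨hp0, henvy⟩, hmin⟩ := hp
  obtain ⟨δ, hδ, hδj, hδl⟩ :
      ∃ δ, 0 < δ ∧ δ ≤ p j ∧ ∀ l, p l < p j → p l + c ≤ p j - δ := by
    obtain ⟨m, -, hm⟩ := Finset.exists_min_image Finset.univ
      (fun l => if p l < p j then p j - p l - c else p j) ⟨j, Finset.mem_univ j⟩
    refine ⟨_, ?_, by simpa using hm j (Finset.mem_univ j), fun l hl => ?_⟩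
    · split_ifs with h
      · linarith [hgap m h]
      · exact hj
    · have := hm l (Finset.mem_univ l)
      simp only [hl, if_true] at this
      linarith
  let S : Finset (Fin n) := {i | p j ≤ p i}
  have hS : ∀ i, i ∈ S ↔ p j ≤ p i := fun i => by simp [S]
  have hσS : ∀ i ∈ S, σ i ∈ S := by
    intro i hi
    rw [hS] at *
    by_contra! hlt
    linarith [hgap _ hlt, henvy i i, hw i (σ i)]
  have hσS' : ∀ i, σ i ∈ S → i ∈ S := by
    intro i hi
    have himage : S.image σ = S :=
      Finset.eq_of_subset_of_card_le (Finset.image_subset_iff.2 hσS)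
        (Finset.card_image_of_injective S σ.injective).ge
    rw [← himage, Finset.mem_image] at hi
    obtain ⟨a, ha, hai⟩ := hi
    rwa [← σ.injective hai]
  have hfeas : inP w σ (fun i => if i ∈ S then p i - δ else p i) := by
    refine ⟨fun i => ?_, fun i l => ?_⟩
    · dsimp only
      split_ifs with h
      · linarith [(hS i).1 h]
      · exact hp0 i
    · have he := henvy i l
      dsimp only
      by_cases h1 : σ i ∈ S <;> by_cases h2 : l ∈ S <;> simp only [h1, h2, if_true, if_false]
      · linarith
      · have hi := (hS i).1 (hσS' i h1)
        rw [hS, not_le] at h2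
        linarith [hδl l h2, hw i l, henvy i i]
      · linarith
      · exact he
  have hle := hmin _ hfeas j
  simp only [(hS j).2 le_rfl, if_true] at hle
  linarith

lemma le_mul_card_lt_of_gap {ι : Type*} [Fintype ι] {p : ι → ℝ} {c : ℝ} (hc : 0 ≤ c)
    (hgap : ∀ j, 0 < p j → ∃ l, p l < p j ∧ p j ≤ p l + c) (j : ι) :
    p j ≤ c * (Finset.univ.filter fun l => p l < p j).card := by
  induction hN : (Finset.univ.filter fun l => p l < p j).card using Nat.strong_induction_on
    generalizing j with
  | _ N ih =>
    rcases le_or_gt (p j) 0 with h0 | h0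
    · exact h0.trans (by positivity)
    obtain ⟨l, hl, hlc⟩ := hgap j h0
    have hlt : (Finset.univ.filter fun m => p m < p l).card < N := by
      rw [← hN]
      refine Finset.card_lt_card (Finset.ssubset_iff_of_subset ?_ |>.2 ⟨l, by simpa, by simp⟩)
      intro m hm
      simp only [Finset.mem_filter, Finset.mem_univ, true_and] at *
      exact hm.trans hl
    have h1 := ih _ hlt l rfl
    have h2 : ((Finset.univ.filter fun m => p m < p l).card : ℝ) + 1 ≤ N := by
      exact_mod_cast hlt
    nlinarith

lemma two_mul_sum_card_lt_le {ι : Type*} [Fintype ι] (p : ι → ℝ) :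
    2 * ∑ j, ((Finset.univ.filter fun l => p l < p j).card : ℝ) ≤
      Fintype.card ι * ((Fintype.card ι : ℝ) - 1) := by
  classical
  have hcard : ∀ j, ((Finset.univ.filter fun l => p l < p j).card : ℝ) =
      ∑ l, if p l < p j then (1 : ℝ) else 0 := fun j => by simp
  simp only [hcard]
  calc 2 * ∑ j, ∑ l, (if p l < p j then (1 : ℝ) else 0)
      = ∑ j, ∑ l, ((if p l < p j then (1 : ℝ) else 0) + if p j < p l then (1 : ℝ) else 0) := by
        simp only [Finset.sum_add_distrib]
        rw [two_mul]
        congr 1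
        exact Finset.sum_comm
    _ ≤ ∑ j : ι, ∑ l : ι, (1 - if j = l then (1 : ℝ) else 0) := by
        refine Finset.sum_le_sum fun j _ => Finset.sum_le_sum fun l _ => ?_
        rcases eq_or_ne j l with rfl | hjl
        · simp
        · rcases lt_trichotomy (p l) (p j) with h | h | h <;> simp [h, hjl, h.not_gt]
    _ = Fintype.card ι * ((Fintype.card ι : ℝ) - 1) := by
        simp
        ring

theorem EFk_min_subsidy_bounds {n : ℕ} (hn : 1 ≤ n) (k : ℕ) (hk : 1 ≤ k)
    {M : Type*} [DecidableEq M] [Fintype M]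
    (v : Fin n → Finset M → ℝ)
    (hmb : ∀ (i : Fin n) (e : M) (X : Finset M), e ∉ X → |v i (insert e X) - v i X| ≤ 1)
    (A : Fin n → Finset M) (hpart : isPartition A)
    (hEFk : EFk v A k)
    (w : Fin n → Fin n → ℝ) (hw : ∀ i j, w i j = v i (A j))
    (σ : Equiv.Perm (Fin n)) (hσ : maxWeightPerm w σ)
    (p : Fin n → ℝ) (hp : minSubsidyVec w σ p) :
    (∀ i j : Fin n, v i (A (σ j)) + p (σ j) ≤ v i (A (σ i)) + p (σ i)) ∧
    (∀ i, p i ≤ (k : ℝ) * ((n : ℝ) - 1)) ∧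
    (∑ i, p i ≤ (k : ℝ) * ((n : ℝ) * ((n : ℝ) - 1) / 2)) := by
  have hc : (0 : ℝ) ≤ k := Nat.cast_nonneg k
  have hwk : ∀ i j, w i j ≤ w i i + k := fun i j => by
    simpa only [hw] using hEFk.value_le_add hmb hpart.1 i j
  have hrank := le_mul_card_lt_of_gap hc fun j => hp.exists_lt_le_add hwk (j := j)
  refine ⟨fun i j => ?_, fun i => (hrank i).trans (mul_le_mul_of_nonneg_left ?_ hc), ?_⟩
  · simpa only [hw] using hp.1.2 i (σ j)
  · have hlt : (Finset.univ.filter fun l => p l < p i).card < n := by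
      simpa using Finset.card_lt_univ_of_notMem
        (s := Finset.univ.filter fun l => p l < p i) (x := i) (by simp)
    have : ((Finset.univ.filter fun l => p l < p i).card : ℝ) + 1 ≤ n := by exact_mod_cast hlt
    linarith
  · refine (Finset.sum_le_sum fun i _ => hrank i).trans ?_
    rw [← Finset.mul_sum]
    refine mul_le_mul_of_nonneg_left ?_ hc
    have h := two_mul_sum_card_lt_le p
    rw [Fintype.card_fin] at h
    linarith
end

section
/- If n ≥ 3 and all valuations are monotone with marginal bound 1, then there exists an allocation A and a subsidy vector p such that (A,p) is envy-free, max_{i∈[n]} p_i ≤ n − 1.5, and Σ_{i∈[n]} p_i ≤ (n² − n − 1)/2. -/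
open Finset in
/-- A linear program over subsidies `q` and utilities `u`: its optimum is attained when the
subsidies carry less weight than the utilities. -/
theorem exists_min_utility_sub_subsidy {ι : Type*} [Fintype ι] [Nonempty ι] (w : ι → ι → ℝ)
    {c : ℝ} (hc0 : 0 ≤ c) (hc : c < 1) :
    ∃ q u : ι → ℝ, (∀ j, 0 ≤ q j) ∧ (∀ i j, w i j + q j ≤ u i) ∧
      ∀ q' u' : ι → ℝ, (∀ j, 0 ≤ q' j) → (∀ i j, w i j + q' j ≤ u' i) →
        ∑ i, u i - c * ∑ j, q j ≤ ∑ i, u' i - c * ∑ j, q' j := by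
  classical
  let U : (ι → ℝ) → ι → ℝ := fun q i => univ.sup' univ_nonempty fun j => w i j + q j
  have hU : ∀ q i j, w i j + q j ≤ U q i := fun q i j =>
    le_sup' (fun j => w i j + q j) (mem_univ j)
  have hUle : ∀ q i x, (∀ j, w i j + q j ≤ x) → U q i ≤ x := fun q i x h =>
    sup'_le _ _ fun j _ => h j
  let F : (ι → ℝ) → ℝ := fun q => ∑ i, U q i - c * ∑ j, q j
  have hF : Continuous F := by
    refine .sub (continuous_finsetSum _ fun i _ => ?_) (by fun_prop)
    exact Continuous.finset_sup'_apply _ fun j _ => by fun_prop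
  obtain ⟨C, hC⟩ : ∃ C, ∀ i j, |w i j| ≤ C := by
    obtain ⟨x, hx⟩ := Finite.exists_max fun x : ι × ι => |w x.1 x.2|
    exact ⟨_, fun i j => hx (i, j)⟩
  have hC0 : 0 ≤ C := (abs_nonneg _).trans (hC (Classical.arbitrary ι) (Classical.arbitrary ι))
  let B : ℝ := 2 * C / (1 - c)
  have hB0 : 0 ≤ B := div_nonneg (by linarith) (by linarith)
  have hcard : (0 : ℝ) < Fintype.card ι := by exact_mod_cast Fintype.card_pos
  have hF0 : F 0 ≤ Fintype.card ι * C := by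
    have : ∑ i, U 0 i ≤ ∑ _i : ι, C := sum_le_sum fun i _ => hUle _ _ _ fun j => by
      simpa using (abs_le.1 (hC i j)).2
    simpa [F] using this
  have hFlarge : ∀ q : ι → ℝ, (∃ j, B < q j) → F 0 ≤ F q := by
    rintro q ⟨j, hj⟩
    obtain ⟨m, hm⟩ := Finite.exists_max q
    have h1 : ∑ _i : ι, (q m - C) ≤ ∑ i, U q i := sum_le_sum fun i _ => by
      have := hU q i m
      have := (abs_le.1 (hC i m)).1
      linarith
    have h2 : ∑ j, q j ≤ ∑ _j : ι, q m := sum_le_sum fun j _ => hm j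
    simp only [sum_const, card_univ, nsmul_eq_mul] at h1 h2
    have h3 : 2 * C ≤ q m * (1 - c) := by
      have : B < q m := hj.trans_le (hm j)
      exact ((div_lt_iff₀ (by linarith)).1 this).le
    have h4 := mul_le_mul_of_nonneg_left h2 hc0
    have h5 := mul_le_mul_of_nonneg_left h3 hcard.le
    have : F q = ∑ i, U q i - c * ∑ j, q j := rfl
    nlinarith
  obtain ⟨q, hq, hmin⟩ := (isCompact_Icc (a := (0 : ι → ℝ)) (b := fun _ => B)).exists_isMinOn
    ⟨0, le_rfl, fun _ => hB0⟩ hF.continuousOn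
  refine ⟨q, U q, hq.1, hU q, fun q' u' hq' hu' => ?_⟩
  have h1 : F q ≤ F q' := by
    by_cases h : ∃ j, B < q' j
    · exact (hmin ⟨le_rfl, fun _ => hB0⟩).trans (hFlarge q' h)
    · push Not at h
      exact hmin ⟨hq', h⟩
  have h2 : ∑ i, U q' i ≤ ∑ i, u' i := sum_le_sum fun i _ => hUle _ _ _ (hu' i)
  have h3 : F q = ∑ i, U q i - c * ∑ j, q j := rfl
  have h4 : F q' = ∑ i, U q' i - c * ∑ j, q' j := rfl
  linarith

theorem exists_pos_forall_eq_zero_or_le {ι : Type*} [Finite ι] (f : ι → ℝ) (hf : ∀ i, 0 ≤ f i) :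
    ∃ ε > 0, ∀ i, f i = 0 ∨ ε ≤ f i := by
  rcases isEmpty_or_nonempty ι with _ | _
  · exact ⟨1, one_pos, fun i => isEmptyElim i⟩
  · obtain ⟨m, hm⟩ := Finite.exists_min fun i => if f i = 0 then 1 else f i
    refine ⟨if f m = 0 then 1 else f m, ?_, fun i => ?_⟩
    · split_ifs with h
      · exact one_pos
      · exact (hf m).lt_of_ne' h
    · by_cases h : f i = 0
      · exact .inl h
      · exact .inr ((hm i).trans (by simp [h]))

open Finset in
/-- There are subsidies `q` on bundles and an assignment `σ` that is envy-free for them. Moreover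
`q` is minimal: every proper set `L` of bundles containing all unsubsidized ones is demanded by more
than `#L` agents. -/
theorem exists_minimal_subsidy {ι : Type*} [Fintype ι] [DecidableEq ι] [Nonempty ι]
    (w : ι → ι → ℝ) :
    ∃ (q u : ι → ℝ) (σ : Equiv.Perm ι), (∀ j, 0 ≤ q j) ∧ (∀ i j, w i j + q j ≤ u i) ∧
      (∀ i, w i (σ i) + q (σ i) = u i) ∧
      ∀ L T : Finset ι, #T ≤ #L → L ≠ univ → (∀ j ∉ L, 0 < q j) →
        ∃ a ∉ T, ∃ l ∈ L, w a l + q l = u a := by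
  have hN : (0 : ℝ) < Fintype.card ι := by exact_mod_cast Fintype.card_pos
  set δ : ℝ := 1 / (Fintype.card ι + 1) with hδ
  have hδ0 : 0 < δ := by positivity
  have hδ1 : δ < 1 := by rw [hδ, div_lt_one (by positivity)]; linarith
  have hδN : δ * Fintype.card ι < 1 := by
    rw [hδ, div_mul_eq_mul_div, div_lt_one (by positivity)]; linarith
  obtain ⟨q, u, hq, hu, hmin⟩ := exists_min_utility_sub_subsidy w (c := 1 - δ)
    (by linarith) (by linarith)
  obtain ⟨ε₁, hε₁, h₁⟩ := exists_pos_forall_eq_zero_or_le q hq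
  obtain ⟨ε₂, hε₂, h₂⟩ := exists_pos_forall_eq_zero_or_le
    (fun x : ι × ι => u x.1 - (w x.1 x.2 + q x.2)) fun x => sub_nonneg.2 (hu x.1 x.2)
  obtain ⟨ε, hε, hεq, hεu⟩ : ∃ ε > 0, (∀ j, q j = 0 ∨ ε ≤ q j) ∧
      ∀ i j, w i j + q j = u i ∨ w i j + q j + ε ≤ u i := by
    refine ⟨min ε₁ ε₂, lt_min hε₁ hε₂, fun j => (h₁ j).imp_right (min_le_left _ _).trans,
      fun i j => (h₂ (i, j)).imp (fun h => ?_) fun h => ?_⟩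
    · simp only at h; linarith
    · simp only at h; linarith [min_le_right ε₁ ε₂]
  have hsum : ∀ (f : ι → ℝ) (S : Finset ι) (t : ℝ),
      ∑ i, (f i + if i ∈ S then t else 0) = ∑ i, f i + #S * t := by
    intro f S t
    simp [sum_add_distrib]
  have hhall : ∀ S : Finset ι, #S ≤ #(S.biUnion fun i => {j | w i j + q j = u i}) := by
    intro S
    by_contra! hS
    set N := S.biUnion fun i => ({j | w i j + q j = u i} : Finset ι)
    have := hmin (fun j => q j + if j ∈ Nᶜ then ε else 0) (fun i => u i + if i ∈ Sᶜ then ε else 0)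
      (fun j => by have := hq j; positivity) ?_
    · rw [hsum, hsum] at this
      have hcS : (#Sᶜ : ℝ) + 1 ≤ #Nᶜ := by
        have h3 := card_add_card_compl S
        have h4 := card_add_card_compl N
        have : #Sᶜ + 1 ≤ #Nᶜ := by omega
        exact_mod_cast this
      have hcN : (#Nᶜ : ℝ) ≤ Fintype.card ι := by exact_mod_cast card_le_univ _
      have h5 : (#Sᶜ : ℝ) - (1 - δ) * #Nᶜ < 0 := by nlinarith
      have := mul_neg_of_neg_of_pos h5 hε
      nlinarith
    · intro i j
      have := hu i j
      by_cases hi : i ∈ S <;> by_cases hj : j ∈ N <;> simp only [mem_compl, hi, hj] <;> simp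
      · linarith
      · rcases hεu i j with h | h
        · exact absurd (mem_biUnion.2 ⟨i, hi, by simpa using h⟩) hj
        · linarith
      · linarith
      · linarith
  obtain ⟨f, hf, hfm⟩ := (all_card_le_biUnion_card_iff_exists_injective _).1 hhall
  refine ⟨q, u, Equiv.ofBijective f (Finite.injective_iff_bijective.1 hf), hq, hu,
    fun i => by simpa using hfm i, fun L T hTL hL hLq => ?_⟩
  by_contra! hT
  have := hmin (fun j => q j + if j ∈ Lᶜ then -ε else 0) (fun i => u i + if i ∈ Tᶜ then -ε else 0)
    (fun j => ?_) ?_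
  · rw [hsum, hsum] at this
    have hcT : (#Lᶜ : ℝ) ≤ #Tᶜ := by
      have h3 := card_add_card_compl L
      have h4 := card_add_card_compl T
      have : #Lᶜ ≤ #Tᶜ := by omega
      exact_mod_cast this
    have hcL : (0 : ℝ) < #Lᶜ := by
      have : 0 < #Lᶜ := card_pos.2 (by rwa [nonempty_iff_ne_empty, Ne, compl_eq_empty_iff])
      exact_mod_cast this
    have h5 : 0 < #Tᶜ - (1 - δ) * #Lᶜ := by nlinarith
    have := mul_pos h5 hε
    nlinarith
  · by_cases hj : j ∈ L
    · simpa [hj] using hq j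
    · rcases hεq j with h | h
      · exact absurd h (hLq j hj).ne'
      · simpa [hj] using h
  · intro i j
    have := hu i j
    by_cases hi : i ∈ T <;> by_cases hj : j ∈ L <;> simp only [mem_compl, hi, hj] <;> simp
    · linarith
    · linarith
    · rcases hεu i j with h | h
      · exact absurd h (hT i hi j hj)
      · linarith
    · linarith

/-- If every envy is at most `1`, then either good subsidies exist, or there are a root agent `a`
and a last agent `b` such that every agent other than `a` envies someone by more than `1/2`, while
`a` is far from envying anyone and nobody envies `b`. -/
theorem exists_good_subsidy_or_chain {n : ℕ} (hn : 3 ≤ n) (w : Fin n → Fin n → ℝ)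
    (hw : ∀ i j, w i j ≤ w i i + 1) :
    (∃ (q : Fin n → ℝ) (σ : Equiv.Perm (Fin n)), (∀ j, 0 ≤ q j) ∧
      (∀ i j, w i j + q j ≤ w i (σ i) + q (σ i)) ∧ (∀ j, q j ≤ (n : ℝ) - 1.5) ∧
      ∑ j, q j ≤ ((n : ℝ) ^ 2 - (n : ℝ) - 1) / 2) ∨
    ∃ a b, a ≠ b ∧ (∀ i ≠ a, ∃ j, w i i + 1 / 2 < w i j) ∧ (∀ j ≠ a, w a j < w a a - 1 / 2) ∧
      w a b < w a a - 3 / 2 ∧ ∀ i ≠ b, w i b ≤ w i i := by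
  have : NeZero n := ⟨by omega⟩
  obtain ⟨q, u, σ, hq, hu, hσ, hcut⟩ := exists_minimal_subsidy w
  set e := Tuple.sort q
  have hmon : ∀ i j : Fin n, i ≤ j → q (e i) ≤ q (e j) := fun i j h => Tuple.monotone_sort q h
  have hqu : ∀ i, w i i + q i ≤ u i := fun i => hu i i
  let L : ℕ → Finset (Fin n) := fun k => {x | (e.symm x : ℕ) < k}
  have hL : ∀ k x, x ∈ L k ↔ (e.symm x : ℕ) < k := fun k x => by simp [L]
  have hcutL : ∀ (k : ℕ) (hk : k < n), 0 < q (e ⟨k, hk⟩) → ∀ T : Finset (Fin n),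
      T.card ≤ (L k).card → ∃ i, e i ∉ T ∧ ∃ j : Fin n, (j : ℕ) < k ∧
        w (e i) (e j) + q (e j) = u (e i) := by
    intro k hk hpos T hT
    obtain ⟨a, haT, l, hl, h⟩ := hcut (L k) T hT
      (fun h => by simpa [h] using hL k (e ⟨k, hk⟩))
      (fun j hj => hpos.trans_le <| by
        have := hmon ⟨k, hk⟩ (e.symm j) (by simpa [hL, Fin.le_def] using hj)
        simpa using this)
    exact ⟨e.symm a, by simpa using haT, e.symm l, (hL _ _).1 hl, by simpa using h⟩
  have hzero : q (e 0) = 0 := by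
    by_contra h
    obtain ⟨i, -, j, hj, -⟩ := hcutL 0 (by omega) ((hq _).lt_of_ne' h) ∅ (by simp)
    omega
  have hgap : ∀ (k : ℕ) (hk : k + 1 < n), q (e ⟨k + 1, hk⟩) ≤ q (e ⟨k, by omega⟩) + 1 := by
    intro k hk
    by_contra! h
    obtain ⟨i, hi, j, hj, htight⟩ := hcutL (k + 1) hk (by linarith [hq (e ⟨k, by omega⟩)]) _ le_rfl
    have h1 := hmon ⟨k + 1, hk⟩ i (by simpa [hL, Fin.le_def] using hi)
    have h2 := hmon j ⟨k, by omega⟩ (by rw [Fin.le_def]; simp only; omega)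
    linarith [hqu (e i), hw (e i) (e j)]
  have hgaps : ∀ (d k : ℕ) (hk : k + d < n), q (e ⟨k + d, hk⟩) ≤ q (e ⟨k, by omega⟩) + d := by
    intro d
    induction d with
    | zero => simp
    | succ d ih =>
      intro k hk
      have h1 := ih k (by omega)
      have h2 := hgap (k + d) (by omega)
      push_cast
      simp only [← add_assoc]
      linarith
  have hle : ∀ i : Fin n, q (e i) ≤ (i : ℕ) := by
    intro i
    have := hgaps i 0 (by omega)
    simpa [hzero] using this
  have hn1 : n - 1 < n := by omega
  by_cases hgood : q (e ⟨n - 1, hn1⟩) ≤ (n : ℝ) - 1.5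
  · left
    refine ⟨q, σ, hq, fun i j => (hσ i).symm ▸ hu i j, fun j => ?_, ?_⟩
    · refine le_trans ?_ hgood
      simpa using hmon (e.symm j) ⟨n - 1, hn1⟩ (by rw [Fin.le_def]; simp only; omega)
    · rw [← Equiv.sum_comp e]
      obtain ⟨m, rfl⟩ : ∃ m, n = m + 1 := ⟨n - 1, by omega⟩
      rw [Fin.sum_univ_castSucc]
      have h1 : ∑ i : Fin m, q (e i.castSucc) ≤ ∑ i : Fin m, (i : ℝ) :=
        Finset.sum_le_sum fun i _ => by simpa using hle i.castSucc
      have h2 : ∑ i : Fin m, ((i : ℕ) : ℝ) = m * (m - 1) / 2 := by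
        rw [Fin.sum_univ_eq_sum_range fun i => (i : ℝ)]
        have := Finset.sum_range_id_mul_two m
        rcases m with _ | m
        · simp
        · simp only [Nat.add_sub_cancel] at this
          have : (∑ i ∈ Finset.range (m + 1), (i : ℝ)) * 2 = ((m + 1) * m : ℕ) := by
            rw [← this]
            push_cast
            rfl
          push_cast at this ⊢
          linarith
      have h3 : q (e (Fin.last m)) ≤ ((m + 1 : ℕ) : ℝ) - 1.5 := hgood
      push_cast at h3 ⊢
      nlinarith
  · right
    push Not at hgood
    have hge : ∀ i : Fin n, (i : ℕ) - 1 / 2 < q (e i) := by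
      intro i
      have h1 := hgaps (n - 1 - i) i (by omega)
      have h2 : (⟨(i : ℕ) + (n - 1 - i), by omega⟩ : Fin n) = ⟨n - 1, hn1⟩ := by
        ext; simp only; omega
      rw [h2] at h1
      have h3 : (((n - 1 - (i : ℕ) : ℕ)) : ℝ) = n - 1 - (i : ℕ) := by
        rw [Nat.cast_sub (by omega), Nat.cast_sub (by omega)]; simp
      rw [h3] at h1
      norm_num at hgood h1
      linarith
    have htight : ∀ (k : ℕ) (hk : k + 1 < n),
        w (e ⟨k + 1, hk⟩) (e ⟨k, by omega⟩) + q (e ⟨k, by omega⟩) = u (e ⟨k + 1, hk⟩) := by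
      intro k hk
      have hpos := hge ⟨k + 1, hk⟩
      push_cast at hpos
      have hk0 : (0 : ℝ) ≤ k := k.cast_nonneg
      obtain ⟨i, hi, j, hj, h⟩ := hcutL (k + 1) hk (by linarith) _ le_rfl
      have hi' : k + 1 ≤ (i : ℕ) := by simpa [hL] using hi
      have h1 : (i : ℕ) < (j : ℕ) + 2 := by
        have h2 := hge i
        have h3 := hle j
        have h4 : ((i : ℕ) : ℝ) < (j : ℕ) + 2 := by linarith [hqu (e i), hw (e i) (e j)]
        exact_mod_cast h4
      obtain rfl : i = ⟨k + 1, hk⟩ := by ext; simp only; omega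
      have hjk : j = ⟨k, by omega⟩ := by ext; simp only at h1 ⊢; omega
      rwa [hjk] at h
    have hroot : u (e 0) = w (e 0) (e 0) := by
      have hpos := hge ⟨1, by omega⟩
      obtain ⟨i, hi, j, hj, h⟩ := hcutL 1 (by omega) (by norm_num at hpos ⊢; linarith)
        {e ⟨1, by omega⟩} (by
          rw [Finset.card_singleton, Nat.succ_le_iff, Finset.card_pos]
          exact ⟨e 0, by simp [hL]⟩)
      obtain rfl : j = 0 := Fin.val_eq_zero_iff.1 (by omega)
      have hi1 : (i : ℕ) ≠ 1 := fun h => hi (by simp [← h])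
      have h2 : (i : ℕ) < 2 := by
        have h3 := hge i
        have h4 : ((i : ℕ) : ℝ) < 2 := by linarith [hqu (e i), hw (e i) (e 0)]
        exact_mod_cast h4
      obtain rfl : i = 0 := Fin.val_eq_zero_iff.1 (by omega)
      linarith
    have hn3 : (3 : ℝ) ≤ n := by exact_mod_cast hn
    have hpred : ∀ i : Fin n, i ≠ 0 → ∃ (k : ℕ) (hk : k + 1 < n), i = ⟨k + 1, hk⟩ := by
      intro i hi
      have : (i : ℕ) ≠ 0 := fun h => hi (by ext; simpa using h)
      exact ⟨i - 1, by omega, by ext; simp only; omega⟩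
    refine ⟨e 0, e ⟨n - 1, hn1⟩, fun h => ?_, fun i hi => ?_, fun j hj => ?_, ?_, fun i hi => ?_⟩
    · have := congrArg Fin.val (e.injective h)
      simp at this
      omega
    · obtain ⟨i, rfl⟩ := e.surjective i
      obtain ⟨k, hk, rfl⟩ := hpred i fun h => hi (by rw [h])
      refine ⟨e ⟨k, by omega⟩, ?_⟩
      have h1 := hge ⟨k + 1, hk⟩
      have h2 := hle ⟨k, by omega⟩
      push_cast at h1 h2
      linarith [htight k hk, hqu (e ⟨k + 1, hk⟩)]
    · obtain ⟨j, rfl⟩ := e.surjective j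
      obtain ⟨k, hk, rfl⟩ := hpred j fun h => hj (by rw [h])
      have h1 := hge ⟨k + 1, hk⟩
      have hk0 : (0 : ℝ) ≤ k := k.cast_nonneg
      push_cast at h1
      linarith [hu (e 0) (e ⟨k + 1, hk⟩)]
    · norm_num at hgood
      linarith [hu (e 0) (e ⟨n - 1, hn1⟩)]
    · obtain ⟨i, rfl⟩ := e.surjective i
      have hin : (i : ℕ) ≠ n - 1 := fun h => hi (by congr 1; ext; exact h)
      norm_num at hgood
      by_cases h0 : i = 0
      · subst h0
        linarith [hu (e 0) (e ⟨n - 1, hn1⟩)]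
      · obtain ⟨k, hk, rfl⟩ := hpred i h0
        have h2 := hle ⟨k, by omega⟩
        have h3 : (k : ℝ) + 3 ≤ n := by
          simp only at hin
          have : k + 3 ≤ n := by omega
          exact_mod_cast this
        push_cast at h2
        linarith [htight k hk, hu (e ⟨k + 1, hk⟩) (e ⟨n - 1, hn1⟩),
          hw (e ⟨k + 1, hk⟩) (e ⟨k, by omega⟩)]

theorem isPartition.comp_perm {n : ℕ} {M : Type*} [DecidableEq M] [Fintype M]
    {A : Fin n → Finset M} (hA : isPartition A) (σ : Equiv.Perm (Fin n)) :
    isPartition fun i => A (σ i) := by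
  refine ⟨fun i j hij => hA.1 _ _ (σ.injective.ne hij), ?_⟩
  rw [← hA.2]
  ext x
  simp only [Finset.mem_biUnion, Finset.mem_univ, true_and]
  exact ⟨fun ⟨i, hi⟩ => ⟨_, hi⟩, fun ⟨i, hi⟩ => ⟨σ.symm i, by simpa using hi⟩⟩

/-- If every bundle `j` is envied by `f j`, then reassigning along the cycles of `f` improves the
total value. -/
theorem exists_perm_improving {ι : Type*} [Finite ι] [Nonempty ι] (w : ι → ι → ℝ)
    (f : ι → ι) (hf : ∀ j, w (f j) (f j) < w (f j) j) :
    ∃ g : Equiv.Perm ι, (∀ i, w i i ≤ w i (g i)) ∧ ∃ i, w i i < w i (g i) := by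
  classical
  let e : Equiv.Perm (Function.periodicPts f) := (Function.bijOn_periodicPts f).equiv f
  have he : ∀ x, (e x : ι) = f x := fun _ => rfl
  have hinv : ∀ x (hx : x ∈ Function.periodicPts f),
      w x x < w x (Equiv.Perm.ofSubtype e⁻¹ x) := by
    intro x hx
    rw [Equiv.Perm.ofSubtype_apply_of_mem _ hx]
    have h : x = f (e⁻¹ ⟨x, hx⟩ : Function.periodicPts f) := by
      rw [← he, show e (e⁻¹ ⟨x, hx⟩) = ⟨x, hx⟩ from e.apply_symm_apply _]
    generalize ((e⁻¹ ⟨x, hx⟩ : Function.periodicPts f) : ι) = y at h ⊢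
    subst h
    exact hf y
  refine ⟨Equiv.Perm.ofSubtype e⁻¹, fun i => ?_, ?_⟩
  · by_cases hi : i ∈ Function.periodicPts f
    · exact (hinv i hi).le
    · rw [Equiv.Perm.ofSubtype_apply_of_not_mem _ hi]
  · let x := Classical.arbitrary ι
    obtain ⟨m, k, hmk, h⟩ := Finite.exists_ne_map_eq_of_infinite fun m : ℕ => f^[m] x
    wlog hlt : m < k generalizing m k
    · exact this k m hmk.symm h.symm (by omega)
    refine ⟨f^[m] x, hinv _ (Function.mk_mem_periodicPts (n := k - m) (by omega) ?_)⟩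
    rw [Function.IsPeriodicPt, Function.IsFixedPt, ← Function.iterate_add_apply,
      Nat.sub_add_cancel hlt.le]
    exact h.symm

/-- Envy-cycle elimination. -/
theorem exists_unenvied_of_envy_le_one {ι : Type*} [Fintype ι] [Nonempty ι]
    (w : ι → ι → ℝ) (hw : ∀ i j, w i j ≤ w i i + 1) :
    ∃ σ : Equiv.Perm ι, (∀ i j, w i j ≤ w i (σ i) + 1) ∧ ∃ k, ∀ i, w i (σ k) ≤ w i (σ i) := by
  classical
  obtain ⟨σ, hσ, hmax⟩ := Finset.exists_max_image
    ({σ | ∀ i j, w i j ≤ w i (σ i) + 1} : Finset (Equiv.Perm ι)) (fun σ => ∑ i, w i (σ i))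
    ⟨1, by simpa using hw⟩
  simp only [Finset.mem_filter, Finset.mem_univ, true_and] at hσ hmax
  refine ⟨σ, hσ, ?_⟩
  by_contra! h
  choose f hf using h
  obtain ⟨g, hg, i, hi⟩ := exists_perm_improving (fun i j => w i (σ j)) f hf
  refine absurd (hmax (g.trans σ) fun i j => (hσ i j).trans ?_) (not_le.2 ?_)
  · simpa using hg i
  · exact Finset.sum_lt_sum (fun i _ => by simpa using hg i)
      ⟨i, Finset.mem_univ _, by simpa using hi⟩

theorem exists_partition_envy_le_one {n : ℕ} [NeZero n] {M : Type*} [DecidableEq M] [Fintype M]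
    (v : Fin n → Finset M → ℝ)
    (hmono : ∀ (i : Fin n) (X Y : Finset M), X ⊆ Y → v i X ≤ v i Y)
    (hmb : ∀ i (e : M) (X : Finset M), v i (insert e X) ≤ v i X + 1) :
    ∃ A : Fin n → Finset M, isPartition A ∧ ∀ i j, v i (A j) ≤ v i (A i) + 1 := by
  suffices H : ∀ s : Finset M, ∃ A : Fin n → Finset M, (∀ i j, i ≠ j → Disjoint (A i) (A j)) ∧
      Finset.univ.biUnion A = s ∧ ∀ i j, v i (A j) ≤ v i (A i) + 1 by
    obtain ⟨A, h1, h2, h3⟩ := H Finset.univ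
    exact ⟨A, ⟨h1, h2⟩, h3⟩
  intro s
  induction s using Finset.induction_on with
  | empty => exact ⟨fun _ => ∅, by simp, by ext; simp, by simp⟩
  | insert e s hes ih =>
    obtain ⟨A, hd, hs, hA⟩ := ih
    obtain ⟨σ, hσ, k, hk⟩ := exists_unenvied_of_envy_le_one (fun i j => v i (A j)) hA
    have he : ∀ j, e ∉ A j := fun j hj =>
      hes (hs ▸ Finset.mem_biUnion.2 ⟨j, Finset.mem_univ _, hj⟩)
    refine ⟨Function.update (fun i => A (σ i)) k (insert e (A (σ k))), ?_, ?_, ?_⟩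
    · intro i j hij
      have := hd _ _ (σ.injective.ne hij)
      by_cases hi : i = k
      · subst hi
        simpa [Function.update_of_ne hij.symm, he] using this
      · by_cases hj : j = k
        · subst hj
          simpa [Function.update_of_ne hij, he] using this
        · simpa [Function.update_of_ne hi, Function.update_of_ne hj] using this
    · ext x
      have hx : x ∈ s ↔ ∃ i, x ∈ A (σ i) := by
        rw [← hs]
        simpa using σ.surjective.exists
      simp only [Finset.mem_biUnion, Finset.mem_univ, true_and, Finset.mem_insert, hx,
        Function.update_apply]
      constructor
      · rintro ⟨i, hi⟩
        split_ifs at hi with h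
        · exact (Finset.mem_insert.1 hi).imp_right fun h => ⟨k, h⟩
        · exact .inr ⟨i, hi⟩
      · rintro (rfl | ⟨i, hi⟩)
        · exact ⟨k, by simp⟩
        · exact ⟨i, by split_ifs with h <;> simp_all⟩
    · intro i j
      have h1 := hσ i (σ j)
      have h2 := hk i
      have h3 := hmb i e (A (σ k))
      have h4 : v i (A (σ i)) ≤
          v i (Function.update (fun i => A (σ i)) k (insert e (A (σ k))) i) := by
        rw [Function.update_apply]
        split_ifs with h
        · subst h
          exact hmono _ _ _ (Finset.subset_insert _ _)
        · exact le_rfl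
      refine le_trans ?_ (add_le_add_left h4 1)
      rw [Function.update_apply]
      split_ifs with h
      · linarith
      · exact h1

theorem isPartition.move {n : ℕ} {M : Type*} [DecidableEq M] [Fintype M]
    {A : Fin n → Finset M} (hA : isPartition A) {a b : Fin n} (hab : a ≠ b) {f : M}
    (hf : f ∈ A a) :
    isPartition (Function.update (Function.update A a ((A a).erase f)) b (insert f (A b))) := by
  have hmem : ∀ i x, x ∈ Function.update (Function.update A a ((A a).erase f)) b
      (insert f (A b)) i ↔ if x = f then i = b else x ∈ A i := by
    intro i x
    have : f ∈ A i → i = a := fun h => by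
      by_contra hia
      exact Finset.disjoint_left.1 (hA.1 i a hia) h hf
    grind [Function.update_apply]
  refine ⟨fun i j hij => Finset.disjoint_left.2 fun x => ?_, Finset.eq_univ_of_forall fun x => ?_⟩
  · rw [hmem, hmem]
    split_ifs with h
    · rintro rfl
      exact hij.symm
    · exact fun h => Finset.disjoint_left.1 (hA.1 i j hij) h
  · simp only [Finset.mem_biUnion, Finset.mem_univ, true_and, hmem]
    split_ifs with h
    · exact ⟨b, rfl⟩
    · have hx := Finset.mem_univ x
      rw [← hA.2] at hx
      simpa using hx

/-- If every envy is at most `1` and `a` envies nobody by more than `1/2`, then moving items away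
from `a` eventually leads to an allocation with good subsidies. -/
theorem exists_good_allocation_of_envy_le_one {n : ℕ} (hn : 3 ≤ n)
    {M : Type*} [DecidableEq M] [Fintype M]
    (v : Fin n → Finset M → ℝ)
    (hmono : ∀ (i : Fin n) (X Y : Finset M), X ⊆ Y → v i X ≤ v i Y)
    (hmb : ∀ i (e : M) (X : Finset M), v i (insert e X) ≤ v i X + 1)
    (a : Fin n) (A : Fin n → Finset M) (hpart : isPartition A)
    (hA : ∀ i j, v i (A j) ≤ v i (A i) + 1) (ha : ∀ j, v a (A j) ≤ v a (A a) + 1 / 2) :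
    ∃ (A : Fin n → Finset M) (p : Fin n → ℝ),
      isPartition A ∧ (∀ i, 0 ≤ p i) ∧ envyFree v A p ∧
      (∀ i, p i ≤ (n : ℝ) - 1.5) ∧
      ∑ i, p i ≤ ((n : ℝ) ^ 2 - (n : ℝ) - 1) / 2 := by
  induction hm : (A a).card using Nat.strong_induction_on generalizing A with
  | _ m ih =>
  rcases exists_good_subsidy_or_chain hn (fun i j => v i (A j)) hA with
    ⟨q, σ, hq0, hq, hqle, hsum⟩ | ⟨a', b, hab, hne, hfar, hfarb, hb⟩
  · exact ⟨fun i => A (σ i), fun i => q (σ i), hpart.comp_perm σ, fun i => hq0 _,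
      fun i j => hq i (σ j), fun i => hqle _, by rwa [Equiv.sum_comp σ q]⟩
  obtain rfl : a = a' := by
    by_contra h
    obtain ⟨j, hj⟩ := hne a h
    exact absurd (ha j) (not_le.2 hj)
  obtain ⟨f, hf⟩ : (A a).Nonempty := by
    rw [Finset.nonempty_iff_ne_empty]
    intro h
    have := hmono a (A a) (A b) (by simp [h])
    linarith
  have hpart' := hpart.move hab hf
  set A' := Function.update (Function.update A a ((A a).erase f)) b (insert f (A b)) with hA'
  have hAa : A' a = (A a).erase f := by simp [hA', hab]
  have hAb : A' b = insert f (A b) := by simp [hA']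
  have hAo : ∀ j, j ≠ a → j ≠ b → A' j = A j := fun j h1 h2 => by simp [hA', h1, h2]
  have hloss : v a (A a) ≤ v a (A' a) + 1 := by
    have := hmb a f ((A a).erase f)
    rwa [Finset.insert_erase hf, ← hAa] at this
  have hgain : ∀ i, v i (A' b) ≤ v i (A b) + 1 := fun i => hAb ▸ hmb i f (A b)
  have hle : ∀ i j, j ≠ b → v i (A' j) ≤ v i (A j) := by
    intro i j hj
    by_cases h : j = a
    · rw [h, hAa]
      exact hmono _ _ _ (Finset.erase_subset _ _)
    · rw [hAo j h hj]
  have hown : ∀ i, i ≠ a → v i (A i) ≤ v i (A' i) := by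
    intro i hi
    by_cases h : i = b
    · rw [h, hAb]
      exact hmono _ _ _ (Finset.subset_insert _ _)
    · rw [hAo i hi h]
  have ha' : ∀ j, v a (A' j) ≤ v a (A' a) + 1 / 2 := by
    intro j
    by_cases hja : j = a
    · subst hja; linarith
    by_cases hjb : j = b
    · subst hjb; linarith [hgain a]
    · linarith [hle a j hjb, hfar j hja]
  refine ih _ ?_ A' hpart' (fun i j => ?_) ha' rfl
  · rw [← hm, hAa]
    exact Finset.card_erase_lt_of_mem hf
  · by_cases hia : i = a
    · subst hia; linarith [ha' j]
    by_cases hjb : j = b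
    · subst hjb
      by_cases hij : i = j
      · subst hij; linarith
      · linarith [hgain i, hb i hij, hown i hia]
    · linarith [hle i j hjb, hA i j, hown i hia]

theorem monotone_improved_envy_free_subsidy {n : ℕ} (hn : 3 ≤ n)
    {M : Type*} [DecidableEq M] [Fintype M]
    (v : Fin n → Finset M → ℝ)
    (hmono : ∀ (i : Fin n) (X Y : Finset M), X ⊆ Y → v i X ≤ v i Y)
    (hmb : ∀ (i : Fin n) (e : M) (X : Finset M), e ∉ X → |v i (insert e X) - v i X| ≤ 1) :
    ∃ (A : Fin n → Finset M) (p : Fin n → ℝ),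
      isPartition A ∧ (∀ i, 0 ≤ p i) ∧ envyFree v A p ∧
      (∀ i, p i ≤ (n : ℝ) - 1.5) ∧
      ∑ i, p i ≤ ((n : ℝ) ^ 2 - (n : ℝ) - 1) / 2 := by
  have : NeZero n := ⟨by omega⟩
  have hmb' : ∀ i (e : M) (X : Finset M), v i (insert e X) ≤ v i X + 1 := by
    intro i e X
    by_cases he : e ∈ X
    · rw [Finset.insert_eq_of_mem he]
      linarith
    · linarith [(abs_le.1 (hmb i e X he)).2]
  obtain ⟨A, hpart, hA⟩ := exists_partition_envy_le_one v hmono hmb'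
  rcases exists_good_subsidy_or_chain hn (fun i j => v i (A j)) hA with
    ⟨q, σ, hq0, hq, hqle, hsum⟩ | ⟨a, b, hab, -, hfar, -, -⟩
  · exact ⟨fun i => A (σ i), fun i => q (σ i), hpart.comp_perm σ, fun i => hq0 _,
      fun i j => hq i (σ j), fun i => hqle _, by rwa [Equiv.sum_comp σ q]⟩
  · refine exists_good_allocation_of_envy_le_one hn v hmono hmb' a A hpart hA fun j => ?_
    by_cases h : j = a
    · subst h; linarith
    · linarith [hfar j h]
end

section
/- Let w ∈ ℝ^{[n]×[n]} and let σ and σ' both be maximum weight permutations for w. Let p be the minimum subsidy vector for w with respect to σ and p' the minimum subsidy vector for w with respect to σ'. Then p = p'. (In fact, p ∈ P^{σ'} and p' ∈ P^{σ}.) -/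
/-- For a maximum weight permutation `σ'`, every subsidy vector of `P^σ` lies in `P^σ'`. -/
theorem inP.of_maxWeightPerm {n : ℕ} {w : Fin n → Fin n → ℝ} {σ σ' : Equiv.Perm (Fin n)}
    {p : Fin n → ℝ} (hσ' : maxWeightPerm w σ') (hp : inP w σ p) : inP w σ' p := by
  have sum_eq : ∑ i, (w i (σ' i) + p (σ' i)) = ∑ i, (w i (σ i) + p (σ i)) := by
    apply le_antisymm (Finset.sum_le_sum fun i _ => hp.2 i (σ' i))
    rw [Finset.sum_add_distrib, Finset.sum_add_distrib, Equiv.sum_comp σ p, Equiv.sum_comp σ' p]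
    exact add_le_add_left (hσ' σ) _
  have tight := (Finset.sum_eq_sum_iff_of_le fun i _ => hp.2 i (σ' i)).1 sum_eq
  exact ⟨hp.1, fun i j => (hp.2 i j).trans_eq (tight i (Finset.mem_univ i)).symm⟩

theorem min_subsidy_independent_of_max_weight_perm {n : ℕ}
    (w : Fin n → Fin n → ℝ)
    (σ σ' : Equiv.Perm (Fin n))
    (hσ : maxWeightPerm w σ) (hσ' : maxWeightPerm w σ')
    (p p' : Fin n → ℝ)
    (hp : minSubsidyVec w σ p) (hp' : minSubsidyVec w σ' p') :
    p = p' ∧ inP w σ' p ∧ inP w σ p' := by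
  have hpσ' : inP w σ' p := hp.1.of_maxWeightPerm hσ'
  have hp'σ : inP w σ p' := hp'.1.of_maxWeightPerm hσ
  exact ⟨funext fun i => le_antisymm (hp.2 p' hp'σ i) (hp'.2 p hpσ' i), hpσ', hp'σ⟩
end

section
/- Let A be an allocation, w_{i,j} = v_i(A_j), σ* a maximum weight permutation for w, and p* the minimum subsidy vector for w with respect to σ*. Define q_i = max_{j∈[n]}(w_{i,j}+p*_j), r_i = q_i − (w_{i,i}+p*_i) ≥ 0, and the matrix ŵ with ŵ_{i,i} = v_i(A_i)+r_i and ŵ_{i,j} = v_i(A_j) for i≠j. Then the identity permutation is a maximum weight permutation for ŵ, and the minimum subsidy vector for ŵ (with respect to the identity) equals p*. -/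
/-- A permutation admitting an envy-eliminating subsidy vector is a maximum weight permutation. -/
theorem inP.maxWeightPerm {n : ℕ} {w : Fin n → Fin n → ℝ} {σ : Equiv.Perm (Fin n)}
    {p : Fin n → ℝ} (h : inP w σ p) : maxWeightPerm w σ := by
  intro τ
  have hle : ∑ i, (w i (τ i) + p (τ i)) ≤ ∑ i, (w i (σ i) + p (σ i)) :=
    Finset.sum_le_sum fun i _ => h.2 i (τ i)
  rw [Finset.sum_add_distrib, Finset.sum_add_distrib, Equiv.sum_comp τ p,
    Equiv.sum_comp σ p] at hle
  linarith

/-- A real function that does not decrease along a permutation of a finite type is invariant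
under it. -/
theorem Equiv.Perm.apply_eq_of_forall_le {α : Type*} [Fintype α] (σ : Equiv.Perm α)
    {d : α → ℝ} (h : ∀ i, d i ≤ d (σ i)) (i : α) : d i = d (σ i) :=
  (Finset.sum_eq_sum_iff_of_le fun i _ => h i).1 (Equiv.sum_comp σ d).symm i (Finset.mem_univ i)

theorem hat_w_identity_max_weight_and_same_min_subsidy {n : ℕ}
    {M : Type*} [DecidableEq M] [Fintype M]
    (v : Fin n → Finset M → ℝ)
    (A : Fin n → Finset M) (hpart : isPartition A)
    (w : Fin n → Fin n → ℝ) (hw : ∀ i j, w i j = v i (A j))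
    (σ : Equiv.Perm (Fin n)) (hσ : maxWeightPerm w σ)
    (p : Fin n → ℝ) (hp : minSubsidyVec w σ p)
    (q : Fin n → ℝ) (hq : ∀ i, IsGreatest (Set.range fun j => w i j + p j) (q i))
    (r : Fin n → ℝ) (hr : ∀ i, r i = q i - (w i i + p i))
    (wh : Fin n → Fin n → ℝ)
    (hwh : ∀ i j, wh i j = if i = j then v i (A i) + r i else v i (A j)) :
    maxWeightPerm wh (Equiv.refl (Fin n)) ∧ minSubsidyVec wh (Equiv.refl (Fin n)) p := by
  have hq_ge : ∀ i j, w i j + p j ≤ q i := fun i j => (hq i).2 ⟨j, rfl⟩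
  have hq_eq : ∀ i, q i = w i (σ i) + p (σ i) := by
    intro i
    obtain ⟨j, hj⟩ := (hq i).1
    exact le_antisymm (hj ▸ hp.1.2 i j) (hq_ge i (σ i))
  have hdiag : ∀ i, wh i i + p i = q i := by
    intro i
    rw [hwh, if_pos rfl, hr, hw]
    ring
  have hoff : ∀ i j, i ≠ j → wh i j = w i j := by
    intro i j hij
    rw [hwh, if_neg hij, hw]
  have hle : ∀ i j, w i j ≤ wh i j := by
    intro i j
    rcases eq_or_ne i j with rfl | hij
    · linarith [hdiag i, hq_ge i i]
    · exact (hoff i j hij).ge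
  have hmem : inP wh (Equiv.refl (Fin n)) p := by
    refine ⟨hp.1.1, fun i j => ?_⟩
    rw [Equiv.refl_apply, hdiag]
    rcases eq_or_ne i j with rfl | hij
    · exact (hdiag i).le
    · exact hoff i j hij ▸ hq_ge i j
  refine ⟨hmem.maxWeightPerm, hmem, fun p' hp' => hp.2 p' ⟨hp'.1, ?_⟩⟩
  have key : ∀ i j, w i j + p' j ≤ q i - p i + p' i := by
    intro i j
    have h := hp'.2 i j
    rw [Equiv.refl_apply] at h
    linarith [hle i j, hdiag i]
  have hinv : ∀ i, p i - p' i = p (σ i) - p' (σ i) :=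
    σ.apply_eq_of_forall_le (d := fun i => p i - p' i)
      fun i => by linarith [key i (σ i), hq_eq i]
  intro i j
  linarith [key i j, hinv i, hq_eq i]
end

section
/- Let A = (A_1,…,A_n) be an allocation, let r_1,…,r_n ∈ ℝ, and define ŵ by ŵ_{i,i} = v_i(A_i)+r_i and ŵ_{i,j} = v_i(A_j) for i≠j. Assume the identity permutation is a maximum weight permutation for ŵ. For k = 2,…,n define s_k = 1 + r_k + v_k(A_k) − v_k(A_{k−1}). Then for all i,j∈[n] with i < j: v_i(A_j) − v_i(A_i) − r_i ≤ −Σ_{k=i+1}^{j} (1 − s_k). -/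
/-- The permutation of `Fin n` sending `i` to `j`, lowering every element of `(i, j]` by one, and
fixing all other elements. -/
noncomputable def backwardCycle {n : ℕ} (i j : Fin n) (hij : i < j) : Equiv.Perm (Fin n) :=
  Equiv.ofBijective
    (fun k => if k = i then j else if k ∈ Finset.Ioc i j then
      ⟨(k : ℕ) - 1, Nat.lt_of_le_of_lt (Nat.sub_le _ _) k.isLt⟩ else k)
    (Finite.injective_iff_bijective.mp (by
      intro a b hab
      simp only [Finset.mem_Ioc] at hab
      split_ifs at hab <;> simp only [Fin.ext_iff, Fin.lt_def, Fin.le_def] at * <;> omega))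

theorem backwardCycle_apply {n : ℕ} (i j : Fin n) (hij : i < j) (k : Fin n) :
    backwardCycle i j hij k = if k = i then j else if k ∈ Finset.Ioc i j then
      ⟨(k : ℕ) - 1, Nat.lt_of_le_of_lt (Nat.sub_le _ _) k.isLt⟩ else k :=
  rfl

theorem no_positive_cycle_path_bound {n : ℕ} (hn : 1 ≤ n)
    {M : Type*} [DecidableEq M] [Fintype M]
    (v : Fin n → Finset M → ℝ)
    (A : Fin n → Finset M) (hpart : isPartition A)
    (r : Fin n → ℝ)
    (wh : Fin n → Fin n → ℝ)
    (hwh : ∀ i j, wh i j = if i = j then v i (A i) + r i else v i (A j))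
    (hid : maxWeightPerm wh (Equiv.refl (Fin n)))
    (s : Fin n → ℝ)
    (hs : ∀ k : Fin n, k ≠ ⟨0, hn⟩ →
      s k = 1 + r k + v k (A k)
        - v k (A ⟨(k : ℕ) - 1, Nat.lt_of_le_of_lt (Nat.sub_le _ _) k.isLt⟩)) :
    ∀ i j : Fin n, i < j →
      v i (A j) - v i (A i) - r i ≤ -∑ k ∈ Finset.Ioc i j, (1 - s k) := by
  intro i j hij
  have hterm : ∀ k, wh k (backwardCycle i j hij k) - wh k k =
      (if k = i then v i (A j) - v i (A i) - r i else 0) +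
        (if k ∈ Finset.Ioc i j then 1 - s k else 0) := by
    intro k
    rw [backwardCycle_apply, hwh, hwh]
    by_cases hk : k = i
    · subst hk
      simp [hij.ne]
      ring
    · by_cases hk' : k ∈ Finset.Ioc i j
      · have hpos : (i : ℕ) < k := (Finset.mem_Ioc.mp hk').1
        have hpred : k ≠ ⟨(k : ℕ) - 1, Nat.lt_of_le_of_lt (Nat.sub_le _ _) k.isLt⟩ := by
          rw [Ne, Fin.ext_iff]
          simp only
          omega
        have hne : k ≠ ⟨0, hn⟩ := by
          rw [Ne, Fin.ext_iff]
          simp only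
          omega
        simp only [if_neg hk, if_pos hk', if_neg hpred, if_true, hs k hne]
        ring
      · simp only [if_neg hk, if_neg hk', if_true]
        ring
  have hsum : ∑ k, (wh k (backwardCycle i j hij k) - wh k k) ≤ 0 := by
    rw [Finset.sum_sub_distrib]
    exact sub_nonpos.mpr (hid (backwardCycle i j hij))
  rw [Finset.sum_congr rfl fun k _ => hterm k, Finset.sum_add_distrib, Finset.sum_ite_eq',
    if_pos (Finset.mem_univ i), Finset.sum_ite_mem, Finset.univ_inter] at hsum
  linarith
end

section
/- Under the Section-4 setup with e*, A' = (A_1∖{e*}, A_2, …, A_{n−1}, A_n∪{e*}) as before, define A'' = (A'_n, A'_1, A'_2, …, A'_{n−1}) and w''_{i,j} = v_i(A''_j). Then for all i,j∈[n]: w''_{1,j} − w''_{1,1} ≤ 0.5 + max{0, v_1(A'_1) − v_1(A'_n)}; w''_{2,j} − w''_{2,2} ≤ s_2 + s_3; and w''_{i,j} − w''_{i,i} ≤ s_i for every i ≥ 3. -/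
/-- The weight of the (simple) path visiting the vertices of the list `l` in order,
in the envy graph `G^{wh, id}` whose edge `(i, j)` has weight `wh i j - wh i i`. -/
def pathWeight {n : ℕ} (wh : Fin n → Fin n → ℝ) (l : List (Fin n)) : ℝ :=
  ((l.zip l.tail).map (fun ab => wh ab.1 ab.2 - wh ab.1 ab.1)).sum

/-- Under monotone valuations an `EF1` allocation of disjoint bundles satisfies the usual goods
version of `EF1`: it suffices to remove one item from the envied bundle. -/
lemma EFk.exists_subset_right {n : ℕ} {M : Type*} [DecidableEq M] {v : Fin n → Finset M → ℝ}
    {A : Fin n → Finset M} {k : ℕ} (h : EFk v A k)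
    (hmono : ∀ (i : Fin n) (X Y : Finset M), X ⊆ Y → v i X ≤ v i Y) (i j : Fin n) :
    ∃ X ⊆ A j, X.card ≤ k ∧ v i (A j \ X) ≤ v i (A i) := by
  obtain ⟨X, -, hcard, hX⟩ := h i j
  refine ⟨A j ∩ X, Finset.inter_subset_left,
    (Finset.card_le_card Finset.inter_subset_right).trans hcard, ?_⟩
  rw [Finset.sdiff_inter_self_left]
  exact hX.trans (hmono i _ _ Finset.sdiff_subset)

/-- A permutation of disjoint bundles is `EFk` as soon as every bundle can be shrunk by at most `k`
items so that it is not preferred to the own bundle. -/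
lemma EFk.of_exists_subset_right {n : ℕ} {M : Type*} [DecidableEq M] {v : Fin n → Finset M → ℝ}
    {A : Fin n → Finset M} {k : ℕ} (hdisj : ∀ i j, i ≠ j → Disjoint (A i) (A j))
    (τ : Equiv.Perm (Fin n))
    (h : ∀ i j, ∃ X ⊆ A j, X.card ≤ k ∧ v i (A j \ X) ≤ v i (A (τ i))) :
    EFk v (fun i => A (τ i)) k := by
  intro i j
  obtain hij | hij := eq_or_ne i j
  · subst hij
    exact ⟨∅, Finset.empty_subset _, by simp, le_rfl⟩
  obtain ⟨X, hXA, hcard, hX⟩ := h i (τ j)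
  refine ⟨X, hXA.trans Finset.subset_union_right, hcard, ?_⟩
  have hd : Disjoint (A (τ i)) X := (hdisj _ _ (τ.injective.ne hij)).mono_right hXA
  simpa only [Finset.sdiff_eq_self_of_disjoint hd] using hX

/-- A set function whose marginals are at most `1` drops by at most `1` when at most one item is
removed. -/
lemma le_sdiff_add_one {M : Type*} [DecidableEq M] {f : Finset M → ℝ}
    (hf : ∀ (e : M) (X : Finset M), e ∉ X → |f (insert e X) - f X| ≤ 1)
    {S X : Finset M} (hXS : X ⊆ S) (hcard : X.card ≤ 1) : f S ≤ f (S \ X) + 1 := by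
  obtain rfl | ⟨e, rfl⟩ : X = ∅ ∨ ∃ e, X = {e} := by
    rw [← Finset.card_eq_zero, ← Finset.card_eq_one]
    omega
  · simp
  · have he : e ∈ S := hXS (Finset.mem_singleton_self e)
    have h := hf e (S.erase e) (Finset.notMem_erase e S)
    rw [Finset.insert_erase he] at h
    rw [Finset.sdiff_singleton_eq_erase]
    linarith [(abs_le.mp h).2]

/-- If every agent gains at least `1/2` from the bundle of its predecessor, then in a
utility-maximal `EF1` permutation the first agent values every other bundle at most `1/2` more than
its own bundle with one item removed. -/
lemma le_erase_add_half {m : ℕ} {M : Type*} [DecidableEq M] {v : Fin (m + 1) → Finset M → ℝ}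
    (hmono : ∀ (i : Fin (m + 1)) (X Y : Finset M), X ⊆ Y → v i X ≤ v i Y)
    (hmb : ∀ (i : Fin (m + 1)) (e : M) (X : Finset M), e ∉ X → |v i (insert e X) - v i X| ≤ 1)
    {A : Fin (m + 1) → Finset M} (hdisj : ∀ i j, i ≠ j → Disjoint (A i) (A j))
    (hEF1 : EFk v A 1)
    (hopt : ∀ σ : Equiv.Perm (Fin (m + 1)),
      EFk v (fun i => A (σ i)) 1 → ∑ i, v i (A (σ i)) ≤ ∑ i, v i (A i))
    (hgain : ∀ j : Fin m, v j.succ (A j.succ) + 1 / 2 ≤ v j.succ (A j.castSucc))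
    {e : M} (he : e ∈ A 0) (j : Fin m) :
    v 0 (A j.succ) ≤ v 0 ((A 0).erase e) + 1 / 2 := by
  obtain ⟨k, -, hk⟩ := Finset.exists_max_image Finset.univ (fun j : Fin m => v 0 (A j.succ))
    ⟨j, Finset.mem_univ j⟩
  replace hk : ∀ j : Fin m, v 0 (A j.succ) ≤ v 0 (A k.succ) := fun j => hk j (Finset.mem_univ j)
  refine (hk j).trans ?_
  by_contra! hlt
  set τ : Equiv.Perm (Fin (m + 1)) := (Fin.cycleRange k.succ).symm with hτ
  have hτ0 : τ 0 = k.succ := Fin.cycleRange_symm_zero _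
  have hτs (i : Fin m) : τ i.succ = k.succ.succAbove i := Fin.cycleRange_symm_succ _ _
  have himp (i : Fin m) : v i.succ (A i.succ) ≤ v i.succ (A (τ i.succ)) := by
    rw [hτs]
    unfold Fin.succAbove
    split_ifs
    · linarith [hgain i]
    · rfl
  have hself : v k.succ (A k.succ) + 1 / 2 ≤ v k.succ (A (τ k.succ)) := by
    rw [hτs, Fin.succAbove_of_castSucc_lt _ _ Fin.castSucc_lt_succ]
    exact hgain k
  have hEF : EFk v (fun i => A (τ i)) 1 := by
    refine EFk.of_exists_subset_right hdisj τ fun i j => ?_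
    cases i using Fin.cases with
    | succ i =>
      obtain ⟨X, hXA, hcard, hX⟩ := hEF1.exists_subset_right hmono i.succ j
      exact ⟨X, hXA, hcard, hX.trans (himp i)⟩
    | zero =>
      rw [hτ0]
      cases j using Fin.cases with
      | succ j => exact ⟨∅, Finset.empty_subset _, by simp, by simpa using hk j⟩
      | zero =>
        refine ⟨{e}, Finset.singleton_subset_iff.mpr he, by simp, ?_⟩
        rw [Finset.sdiff_singleton_eq_erase]
        linarith
  have hsum := hopt τ hEF
  rw [Fin.sum_univ_succ, Fin.sum_univ_succ, hτ0] at hsum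
  have hsingle := Finset.single_le_sum
    (f := fun i : Fin m => v i.succ (A (τ i.succ)) - v i.succ (A i.succ))
    (fun i _ => sub_nonneg.mpr (himp i)) (Finset.mem_univ k)
  rw [Finset.sum_sub_distrib] at hsingle
  have herase := le_sdiff_add_one (hmb 0) (Finset.singleton_subset_iff.mpr he) (by simp)
  rw [Finset.sdiff_singleton_eq_erase] at herase
  linarith

theorem rotated_allocation_edge_weights {n : ℕ} (hn : 3 ≤ n)
    {M : Type*} [DecidableEq M] [Fintype M]
    (v : Fin n → Finset M → ℝ)
    (hmono : ∀ (i : Fin n) (X Y : Finset M), X ⊆ Y → v i X ≤ v i Y)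
    (hmb : ∀ (i : Fin n) (e : M) (X : Finset M), e ∉ X → |v i (insert e X) - v i X| ≤ 1)
    (A : Fin n → Finset M) (hpart : isPartition A)
    (hEF1 : EFk v A 1)
    (hopt : ∀ σ : Equiv.Perm (Fin n),
      EFk v (fun i => A (σ i)) 1 → ∑ i, v i (A (σ i)) ≤ ∑ i, v i (A i))
    (w : Fin n → Fin n → ℝ) (hw : ∀ i j, w i j = v i (A j))
    (σ : Equiv.Perm (Fin n)) (hσ : maxWeightPerm w σ)
    (p : Fin n → ℝ) (hp : minSubsidyVec w σ p)
    (q : Fin n → ℝ) (hq : ∀ i, IsGreatest (Set.range fun j => w i j + p j) (q i))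
    (r : Fin n → ℝ) (hr : ∀ i, r i = q i - (w i i + p i))
    (wh : Fin n → Fin n → ℝ)
    (hwh : ∀ i j, wh i j = if i = j then v i (A i) + r i else v i (A j))
    (s : Fin n → ℝ)
    (hs : ∀ k : Fin n, k ≠ ⟨0, by omega⟩ →
      s k = 1 + r k + v k (A k)
        - v k (A ⟨(k : ℕ) - 1, Nat.lt_of_le_of_lt (Nat.sub_le _ _) k.isLt⟩))
    (hpathmax : ∀ l : List (Fin n), l.Nodup →
      pathWeight wh l ≤ pathWeight wh (List.finRange n).reverse)
    (hweight : (n : ℝ) - 1.5 <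
      ∑ k ∈ Finset.univ.filter (fun k : Fin n => k ≠ ⟨0, by omega⟩), (1 - s k))
    (estar : M) (hestar : estar ∈ A ⟨0, by omega⟩)
    (hestar2 : v ⟨1, by omega⟩ ((A ⟨0, by omega⟩).erase estar) ≤ v ⟨1, by omega⟩ (A ⟨1, by omega⟩))
    (A' : Fin n → Finset M)
    (hA' : ∀ i : Fin n, A' i =
      if i = ⟨0, by omega⟩ then (A ⟨0, by omega⟩).erase estar
      else if i = ⟨n - 1, by omega⟩ then insert estar (A ⟨n - 1, by omega⟩)
      else A i)
    -- the rotated allocation `A'' = (A'_n, A'_1, A'_2, ..., A'_{n-1})`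
    (A'' : Fin n → Finset M)
    (hA'' : ∀ i : Fin n, A'' i = A' (i - ⟨1, by omega⟩))
    (w'' : Fin n → Fin n → ℝ) (hw'' : ∀ i j, w'' i j = v i (A'' j)) :
    (∀ j : Fin n, w'' ⟨0, by omega⟩ j - w'' ⟨0, by omega⟩ ⟨0, by omega⟩ ≤
      0.5 + max 0 (v ⟨0, by omega⟩ (A' ⟨0, by omega⟩) - v ⟨0, by omega⟩ (A' ⟨n - 1, by omega⟩))) ∧
    (∀ j : Fin n, w'' ⟨1, by omega⟩ j - w'' ⟨1, by omega⟩ ⟨1, by omega⟩ ≤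
      s ⟨1, by omega⟩ + s ⟨2, by omega⟩) ∧
    (∀ i j : Fin n, 2 ≤ (i : ℕ) → w'' i j - w'' i i ≤ s i) := by
  obtain ⟨m, rfl⟩ : ∃ m, n = m + 1 := ⟨n - 1, by omega⟩
  have hdisj := hpart.1
  have h0 : (⟨0, by omega⟩ : Fin (m + 1)) = 0 := rfl
  have hlast : (⟨m + 1 - 1, by omega⟩ : Fin (m + 1)) = Fin.last m := rfl
  simp only [h0, hlast] at hs hweight hestar hestar2 hA' ⊢
  have hlast0 : Fin.last m ≠ 0 := by
    rw [Ne, Fin.ext_iff, Fin.val_last, Fin.val_zero]; omega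
  have hEFle (i j : Fin (m + 1)) : v i (A j) ≤ v i (A i) + 1 := by
    obtain ⟨X, hXA, hcard, hX⟩ := hEF1.exists_subset_right hmono i j
    linarith [le_sdiff_add_one (hmb i) hXA hcard]
  have hqle (i j : Fin (m + 1)) : v i (A j) + p j ≤ v i (A i) + r i + p i := by
    have h := (hq i).2 ⟨j, rfl⟩
    simp only [hw] at h
    linarith [hr i, hw i i]
  have hr0 (i : Fin (m + 1)) : 0 ≤ r i := by linarith [hqle i i]
  have hsucc (j : Fin m) : s j.succ =
      1 + r j.succ + v j.succ (A j.succ) - v j.succ (A j.castSucc) :=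
    hs j.succ (Fin.succ_ne_zero j)
  have hs0 (j : Fin m) : 0 ≤ s j.succ := by
    linarith [hsucc j, hr0 j.succ, hEFle j.succ j.castSucc]
  have hsum : ∑ j : Fin m, s j.succ < 1 / 2 := by
    rw [Finset.sum_filter, Fin.sum_univ_succ] at hweight
    simp only [ne_eq, not_true_eq_false, if_false, Fin.succ_ne_zero, not_false_eq_true, if_true,
      zero_add, Finset.sum_sub_distrib, Finset.sum_const, Finset.card_univ, Fintype.card_fin,
      nsmul_eq_mul, mul_one] at hweight
    push_cast at hweight
    linarith
  have hs_half (j : Fin m) : s j.succ < 1 / 2 :=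
    (Finset.single_le_sum (f := fun j : Fin m => s j.succ) (fun j _ => hs0 j)
      (Finset.mem_univ j)).trans_lt hsum
  have hgain (j : Fin m) : v j.succ (A j.succ) + 1 / 2 ≤ v j.succ (A j.castSucc) := by
    linarith [hsucc j, hs_half j, hr0 j.succ]
  have hpstep (j : Fin m) : p j.castSucc + (1 - s j.succ) ≤ p j.succ := by
    linarith [hsucc j, hqle j.succ j.castSucc]
  have hpmono : Monotone p := Fin.monotone_iff_le_succ.mpr fun j => by
    linarith [hpstep j, hs_half j]
  have hA'0 : A' 0 = (A 0).erase estar := by rw [hA', if_pos rfl]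
  have hA'last : A' (Fin.last m) = insert estar (A (Fin.last m)) := by
    rw [hA', if_neg hlast0, if_pos rfl]
  have hA'mid {j : Fin (m + 1)} (h0 : j ≠ 0) (hl : j ≠ Fin.last m) : A' j = A j := by
    rw [hA', if_neg h0, if_neg hl]
  have hA''0 : A'' 0 = A' (Fin.last m) := by
    rw [hA'']
    congr 1
    ext
    simp only [Fin.sub_def, Fin.val_zero, Fin.val_last]
    exact Nat.mod_eq_of_lt (by omega)
  have hA''succ (j : Fin m) : A'' j.succ = A' j.castSucc := by
    rw [hA'']
    congr 1
    ext
    have hj := j.isLt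
    simp only [Fin.sub_def, Fin.val_succ, Fin.val_castSucc]
    rw [show m + 1 - 1 + ((j : ℕ) + 1) = j + (m + 1) by omega, Nat.add_mod_right]
    exact Nat.mod_eq_of_lt (by omega)
  have hinsert (i : Fin (m + 1)) :
      v i (insert estar (A (Fin.last m))) ≤ v i (A (Fin.last m)) + 1 := by
    have hnot : estar ∉ A (Fin.last m) := fun h =>
      Finset.disjoint_left.mp (hdisj _ _ hlast0) h hestar
    linarith [(abs_le.mp (hmb i estar _ hnot)).2]
  have herase (i : Fin (m + 1)) : v i (A 0) ≤ v i ((A 0).erase estar) + 1 := by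
    rw [← Finset.sdiff_singleton_eq_erase]
    exact le_sdiff_add_one (hmb i) (Finset.singleton_subset_iff.mpr hestar) (by simp)
  simp only [hw'']
  refine ⟨fun j => ?_, fun j => ?_, fun i j hi => ?_⟩
  · rw [hA''0, hA'' j]
    generalize j - _ = j
    have hle := le_max_left 0 (v 0 (A' 0) - v 0 (A' (Fin.last m)))
    have hle' := le_max_right 0 (v 0 (A' 0) - v 0 (A' (Fin.last m)))
    by_cases hl : j = Fin.last m
    · subst hl; linarith
    cases j using Fin.cases with
    | zero => linarith
    | succ j =>
      have h := le_erase_add_half hmono hmb hdisj hEF1 hopt hgain hestar j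
      rw [← hA'0, ← hA'mid (Fin.succ_ne_zero j) hl] at h
      linarith
  · obtain ⟨l, rfl⟩ : ∃ l, m = l + 2 := ⟨m - 2, by omega⟩
    have e1 : (⟨1, by omega⟩ : Fin (l + 2 + 1)) = Fin.succ 0 := rfl
    have e2 : (⟨2, by omega⟩ : Fin (l + 2 + 1)) = Fin.succ 1 := rfl
    rw [hA'' j]
    generalize j - _ = j
    rw [e1, e2, hA''succ, Fin.castSucc_zero, hA'0]
    have hs1 := hsucc 0
    rw [Fin.castSucc_zero] at hs1
    have hs1' := hs0 0
    have hs2' := hs0 1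
    have her := herase (Fin.succ 0)
    have hr1 := hr0 (Fin.succ 0)
    have hfar {j : Fin (l + 2 + 1)} (hj : 2 ≤ (j : ℕ)) :
        v (Fin.succ 0) (A j) ≤
          v (Fin.succ 0) (A (Fin.succ 0)) + r (Fin.succ 0) + s (Fin.succ 1) - 1 := by
      have hstep := hpstep 1
      have hm : p (Fin.succ 1) ≤ p j := hpmono (Fin.le_def.mpr hj)
      have hc : (Fin.castSucc 1 : Fin (l + 2 + 1)) = Fin.succ 0 := rfl
      rw [hc] at hstep
      linarith [hqle (Fin.succ 0) j]
    by_cases hj0 : j = 0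
    · rw [hj0, hA'0]; linarith
    by_cases hl : j = Fin.last (l + 2)
    · rw [hl, hA'last]
      have := hfar (j := Fin.last (l + 2)) (by simp)
      linarith [hinsert (Fin.succ 0)]
    rw [hA'mid hj0 hl]
    by_cases hj1 : j = Fin.succ 0
    · rw [hj1]; linarith
    have hj2 : 2 ≤ (j : ℕ) := by
      have h0 := Fin.val_ne_iff.mpr hj0
      have h1 := Fin.val_ne_iff.mpr hj1
      simp only [Fin.val_zero, Fin.val_succ] at h0 h1
      omega
    linarith [hfar hj2]
  · rw [hA'' j]
    generalize j - _ = j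
    cases i using Fin.cases with
    | zero => simp at hi
    | succ i =>
      have hi' : i.castSucc ≠ 0 := by
        rw [Ne, Fin.ext_iff, Fin.val_castSucc, Fin.val_zero]
        rw [Fin.val_succ] at hi
        omega
      rw [hA''succ, hA'mid hi' (Fin.castSucc_lt_last i).ne]
      have hsi := hsucc i
      have hri := hr0 i.succ
      by_cases hj0 : j = 0
      · rw [hj0, hA'0]
        linarith [hmono i.succ _ _ (Finset.erase_subset estar (A 0)), hEFle i.succ 0]
      by_cases hl : j = Fin.last m
      · rw [hl, hA'last]
        linarith [hinsert i.succ, hqle i.succ (Fin.last m), hpmono (Fin.le_last i.succ)]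
      · rw [hA'mid hj0 hl]
        linarith [hEFle i.succ j]
end

section
/- For any weight matrix w ∈ ℝ^{[n]×[n]} and any permutation σ of [n], if p, p' ∈ P^σ, then the componentwise minimum (min{p_i, p'_i})_{i∈[n]} is also in P^σ. Consequently, if P^σ is nonempty, it contains a unique minimal element (a vector p ∈ P^σ with p ≤ p'' componentwise for every p'' ∈ P^σ). -/
/-- The polyhedron `P^σ` is closed under componentwise minima. -/
theorem inP.min {n : ℕ} {w : Fin n → Fin n → ℝ} {σ : Equiv.Perm (Fin n)} {p p' : Fin n → ℝ}
    (hp : inP w σ p) (hp' : inP w σ p') : inP w σ (fun i => min (p i) (p' i)) := by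
  refine ⟨fun i => le_min (hp.1 i) (hp'.1 i), fun i j => ?_⟩
  rw [← min_add_add_left, ← min_add_add_left]
  exact min_le_min (hp.2 i j) (hp'.2 i j)

/-- If `P^σ` is nonempty, the componentwise infimum of its elements is its least element. -/
theorem minSubsidyVec_iInf {n : ℕ} {w : Fin n → Fin n → ℝ} {σ : Equiv.Perm (Fin n)}
    (h : ∃ p, inP w σ p) :
    minSubsidyVec w σ (fun i => ⨅ q : {q // inP w σ q}, q.1 i) := by
  have : Nonempty {q // inP w σ q} := nonempty_subtype.2 h
  have lower (q : Fin n → ℝ) (hq : inP w σ q) (i : Fin n) :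
      ⨅ q : {q // inP w σ q}, q.1 i ≤ q i :=
    ciInf_le ⟨0, Set.forall_mem_range.2 fun q : {q // inP w σ q} => q.2.1 i⟩ ⟨q, hq⟩
  refine ⟨⟨fun i => le_ciInf fun q => q.2.1 i, fun i j => ?_⟩, lower⟩
  rw [← sub_le_iff_le_add']
  refine le_ciInf fun q => ?_
  linarith [lower q.1 q.2 j, q.2.2 i j]

theorem P_sigma_min_closed_and_unique_minimal {n : ℕ}
    (w : Fin n → Fin n → ℝ) (σ : Equiv.Perm (Fin n)) :
    (∀ p p' : Fin n → ℝ, inP w σ p → inP w σ p' →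
      inP w σ (fun i => min (p i) (p' i))) ∧
    ((∃ p, inP w σ p) →
      ∃! p : Fin n → ℝ, inP w σ p ∧ ∀ p'', inP w σ p'' → ∀ i, p i ≤ p'' i) := by
  refine ⟨fun _ _ => inP.min, fun h => ⟨_, minSubsidyVec_iInf h, fun p hp => ?_⟩⟩
  have hmin := minSubsidyVec_iInf h
  exact funext fun i => le_antisymm (hp.2 _ hmin.1 i) (hmin.2 _ hp.1 i)
end

section
/- Fix n ≥ 2 and the following instance: M = {e_{i,j} : i∈[n], j∈[n+1]}; each agent i has the additive valuation with v_i({e_{i',j}}) = n/(n+1) if i'=i, 1 if i'=i−1, and 0 otherwise. Let A_i = {e_{i,1},…,e_{i,n+1}} for each i. Then A = (A_1,…,A_n) is an EF1 allocation, the identity permutation is a maximum weight permutation for w = (v_i(A_j))_{i,j∈[n]} (so A is envy-freeable), and the minimum subsidy vector for w is p = (0, 1, 2, …, n−1); in particular max_i p_i = n−1 and Σ_i p_i = n(n−1)/2. -/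
theorem tight_example_min_subsidy {n : ℕ} (hn : 2 ≤ n)
    (v : Fin n → Finset (Fin n × Fin (n + 1)) → ℝ)
    -- additive valuations: agent `i` values own items `e_{i,j}` at `n/(n+1)`,
    -- items `e_{i-1,j}` of the previous agent at `1`, and all other items at `0`
    (hv : ∀ (i : Fin n) (X : Finset (Fin n × Fin (n + 1))),
      v i X = ∑ e ∈ X,
        (if e.1 = i then (n : ℝ) / (n + 1)
         else if (e.1 : ℕ) + 1 = (i : ℕ) then 1 else 0))
    -- the allocation `A_i = {e_{i,1}, ..., e_{i,n+1}}`
    (A : Fin n → Finset (Fin n × Fin (n + 1)))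
    (hA : ∀ i, A i = Finset.univ.filter (fun e => e.1 = i))
    (w : Fin n → Fin n → ℝ) (hw : ∀ i j, w i j = v i (A j))
    (p : Fin n → ℝ) (hp : ∀ i, p i = ((i : ℕ) : ℝ)) :
    EFk v A 1 ∧
    maxWeightPerm w (Equiv.refl (Fin n)) ∧
    minSubsidyVec w (Equiv.refl (Fin n)) p ∧
    Finset.univ.sup' ⟨⟨0, by omega⟩, Finset.mem_univ _⟩ p = (n : ℝ) - 1 ∧
    ∑ i, p i = (n : ℝ) * ((n : ℝ) - 1) / 2 := by
  have hn0 : (n : ℝ) + 1 ≠ 0 := by positivity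
  have sum_const (i j : Fin n) (X : Finset (Fin n × Fin (n + 1))) (hX : X ⊆ A j) :
      v i X = X.card * (if j = i then (n : ℝ) / (n + 1)
        else if (j : ℕ) + 1 = (i : ℕ) then 1 else 0) := by
    rw [hv, Finset.sum_congr rfl, Finset.sum_const, nsmul_eq_mul]
    intro e he
    have : e.1 = j := by simpa [hA] using hX he
    rw [this]
  have card_A (j : Fin n) : (A j).card = n + 1 := by
    have : A j = {j} ×ˢ Finset.univ := by
      ext ⟨a, b⟩
      simp [hA, eq_comm]
    simp [this]
  have hvA (i j : Fin n) : v i (A j) =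
      if j = i then (n : ℝ) else if (j : ℕ) + 1 = (i : ℕ) then (n : ℝ) + 1 else 0 := by
    rw [sum_const i j _ subset_rfl, card_A]
    push_cast
    split_ifs
    · field_simp
    · ring
    · ring
  have hP : inP w (Equiv.refl (Fin n)) p := by
    refine ⟨fun i => by rw [hp]; positivity, fun i j => ?_⟩
    simp only [hw, hvA, hp, Equiv.refl_apply, if_true]
    split_ifs with h₁ h₂
    · rw [h₁]
    · rw [← h₂]
      push_cast
      linarith
    · have : (j : ℝ) ≤ n := by exact_mod_cast j.2.le
      have : (0 : ℝ) ≤ (i : ℕ) := by positivity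
      linarith
  refine ⟨fun i j => ?_, hP.maxWeightPerm, ⟨hP, fun p' hp' => ?_⟩, ?_, ?_⟩
  · by_cases h : (j : ℕ) + 1 = (i : ℕ)
    · have hji : j ≠ i := by
        rintro rfl
        omega
      have hmem : (j, (0 : Fin (n + 1))) ∈ A j := by simp [hA]
      refine ⟨{(j, 0)}, by simp [hmem], by simp, ?_⟩
      have hAi : A i \ {(j, 0)} = A i :=
        Finset.sdiff_eq_self_of_disjoint (by simp [hA, hji])
      have hcard : (A j \ {(j, 0)}).card = n := by
        rw [Finset.card_sdiff_of_subset (by simpa using hmem), card_A]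
        simp
      rw [hAi, hvA, sum_const i j _ Finset.sdiff_subset, hcard]
      simp [hji, h]
    · refine ⟨∅, by simp, by simp, ?_⟩
      simp only [Finset.sdiff_empty, hvA, h, if_false, if_true]
      split_ifs <;> simp
  · have step : ∀ (k : ℕ) (hk : k < n), (k : ℝ) ≤ p' ⟨k, hk⟩ := by
      intro k
      induction k with
      | zero => exact fun hk => by simpa using hp'.1 ⟨0, hk⟩
      | succ k ih =>
        intro hk
        have h₁ := ih (by omega)
        have h₂ := hp'.2 ⟨k + 1, hk⟩ ⟨k, by omega⟩
        simp [hw, hvA] at h₂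
        push_cast
        linarith
    exact fun i => (hp i).trans_le (step i i.2)
  · apply le_antisymm
    · refine Finset.sup'_le _ _ fun i _ => ?_
      have : ((i : ℕ) : ℝ) + 1 ≤ n := by exact_mod_cast i.2
      rw [hp]
      linarith
    · refine le_trans (le_of_eq ?_)
        (Finset.le_sup' p (Finset.mem_univ (⟨n - 1, by omega⟩ : Fin n)))
      rw [hp]
      simp [Nat.cast_sub (by omega : 1 ≤ n)]
  · simp only [hp]
    rw [Fin.sum_univ_eq_sum_range (fun i => (i : ℝ)) n]
    clear * -
    induction n with
    | zero => simp
    | succ k ih =>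
      rw [Finset.sum_range_succ, ih]
      push_cast
      ring
end
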